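/- Let m ≥ 1 be an integer and suppose g ∈ L²(dν)q⁰ satisfies Δ^m g = f₀. Then for every N ∈ ℕ: g(q^{2N}) = (−1)^m (1−q²)^{2m+1} ∫_0^{2π/h} φ_ρ(q^{2N}) / ((1−q^{1+2iρ})^m (1−q^{1−2iρ})^m) dσ(ρ). -/

import Mathlib

open scoped BigOperators
open Complex

noncomputable section

/-- `q^w = exp(w · ln q)` for real `q > 0` and complex `w`. -/
noncomputable def qpow (q : ℝ) (w : ℂ) : ℂ := Complex.exp (w * (Real.log q : ℂ))

/-- The finite q-Pochhammer symbol `(a;Q)_n = ∏_{j=0}^{n-1} (1 − a Q^j)`. -/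
noncomputable def qPoch (a Q : ℂ) (n : ℕ) : ℂ := ∏ j ∈ Finset.range n, (1 - a * Q ^ j)

/-- The infinite q-Pochhammer symbol `(a;Q)_∞ = ∏_{j=0}^{∞} (1 − a Q^j)`. -/
noncomputable def qPochInf (a Q : ℂ) : ℂ := ∏' j : ℕ, (1 - a * Q ^ j)

/-- The eigenvalue `λ(ρ) = −(1−q^{1+2iρ})(1−q^{1−2iρ})/(1−q²)²`. -/
noncomputable def lambdaQ (q : ℝ) (ρ : ℂ) : ℂ :=
  -((1 - qpow q (1 + 2 * I * ρ)) * (1 - qpow q (1 - 2 * I * ρ))) / (1 - (q : ℂ) ^ 2) ^ 2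

/-- The general term of the series defining the Jost-type solution `ψ_ρ(q^{2m})`. -/
noncomputable def psiTerm (q : ℝ) (ρ : ℂ) (m k : ℕ) : ℂ :=
  (qPoch (qpow q (1 - 2 * I * ρ)) ((q : ℂ) ^ 2) k) ^ 2 * (q : ℂ) ^ (2 * k) *
      (q : ℂ) ^ (2 * k * m) /
    (qPoch (qpow q (2 - 4 * I * ρ)) ((q : ℂ) ^ 2) k * qPoch ((q : ℂ) ^ 2) ((q : ℂ) ^ 2) k)

/-- The Jost-type solution
`ψ_ρ(q^{2m}) = q^{(1−2iρ)m} Σ_{k≥0} ((q^{1−2iρ};q²)_k)² q^{2k} q^{2km} / ((q^{2−4iρ};q²)_k (q²;q²)_k)`. -/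
noncomputable def psiQ (q : ℝ) (ρ : ℂ) (m : ℕ) : ℂ :=
  qpow q ((1 - 2 * I * ρ) * (m : ℂ)) * ∑' k : ℕ, psiTerm q ρ m k

/-- The q-spherical function
`φ_ρ(q^{2m}) = Σ_{k=0}^{m} (q^{-2m};q²)_k (q^{1+2iρ};q²)_k (q^{1−2iρ};q²)_k q^{2k} / ((q²;q²)_k)²`. -/
noncomputable def phiQ (q : ℝ) (ρ : ℂ) (m : ℕ) : ℂ :=
  ∑ k ∈ Finset.range (m + 1),
    qPoch ((q : ℂ) ^ (-(2 * (m : ℤ)))) ((q : ℂ) ^ 2) k *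
        qPoch (qpow q (1 + 2 * I * ρ)) ((q : ℂ) ^ 2) k *
        qPoch (qpow q (1 - 2 * I * ρ)) ((q : ℂ) ^ 2) k * (q : ℂ) ^ (2 * k) /
      (qPoch ((q : ℂ) ^ 2) ((q : ℂ) ^ 2) k) ^ 2

/-- The q-Gamma function `Γ_{q²}(x) = (q²;q²)_∞ (1−q²)^{1−x} / (q^{2x};q²)_∞`, using the
principal branch of the complex power. -/
noncomputable def qGamma (q : ℝ) (x : ℂ) : ℂ :=
  qPochInf ((q : ℂ) ^ 2) ((q : ℂ) ^ 2) * ((1 : ℂ) - (q : ℂ) ^ 2) ^ ((1 : ℂ) - x) /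
    qPochInf (qpow q (2 * x)) ((q : ℂ) ^ 2)

/-- `h = ln(q^{-2})`. -/
noncomputable def hQ (q : ℝ) : ℝ := Real.log (q ^ (-2 : ℤ))

/-- The density of the Plancherel measure `dσ`:
`(1/(4π))·(h/(1−q²))·Γ_{q²}(1/2−iρ)² Γ_{q²}(1/2+iρ)² / (Γ_{q²}(−2iρ) Γ_{q²}(2iρ))`,
which is nonnegative real for real `ρ`. -/
noncomputable def sigmaDensity (q : ℝ) (ρ : ℝ) : ℂ :=
  (1 / (4 * (Real.pi : ℂ))) * ((hQ q : ℂ) / (1 - (q : ℂ) ^ 2)) *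
      (qGamma q (1 / 2 - I * (ρ : ℂ))) ^ 2 * (qGamma q (1 / 2 + I * (ρ : ℂ))) ^ 2 /
    (qGamma q (-(2 * I * (ρ : ℂ))) * qGamma q (2 * I * (ρ : ℂ)))

/-- The Borel measure `dσ` on `[0, 2π/h]` with density `sigmaDensity` with respect to
Lebesgue measure. -/
noncomputable def sigmaMeasure (q : ℝ) : MeasureTheory.Measure ℝ :=
  (MeasureTheory.volume.restrict (Set.Icc 0 (2 * Real.pi / hQ q))).withDensity
    (fun ρ => ENNReal.ofReal (sigmaDensity q ρ).re)

/-- The spherical transform `f̂(ρ) = (1−q²) Σ_{m≥0} φ_ρ(q^{2m}) f(q^{2m}) q^{-2m}`. -/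
noncomputable def sphTransform (q : ℝ) (f : ℕ → ℂ) (ρ : ℝ) : ℂ :=
  (1 - (q : ℂ) ^ 2) * ∑' m : ℕ, phiQ q (ρ : ℂ) m * f m * (q : ℂ) ^ (-(2 * (m : ℤ)))

/-- The weighted counting measure on ℕ with `ν {m} = (1−q²) q^{-2m}`, so that
`MeasureTheory.Lp ℂ 2 (nuMeasure q)` is the Hilbert space `L²(dν)q⁰` of sequences with inner
product `⟨f,g⟩ = (1−q²) Σ_{m≥0} conj(g(q^{2m})) f(q^{2m}) q^{-2m}`. -/
noncomputable def nuMeasure (q : ℝ) : MeasureTheory.Measure ℕ :=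
  MeasureTheory.Measure.count.withDensity
    (fun m => ENNReal.ofReal ((1 - q ^ 2) * q ^ (-(2 * (m : ℤ)))))

/-- The radial part of the q-invariant Laplacian, acting on sequences `f : ℕ → ℂ` (where
`f m` stands for `f(q^{2m})`); for `m = 0` the first bracketed term (carrying the factor
`1−q⁰ = 0`) is set equal to `0`. -/
noncomputable def DeltaQ (q : ℝ) (f : ℕ → ℂ) : ℕ → ℂ := fun m =>
  (q : ℂ) ^ (-1 : ℤ) * (q : ℂ) ^ (4 * (m : ℤ)) *
    ((if m = 0 then 0 else
        (1 - (q : ℂ) ^ (2 * (m : ℤ))) * (f (m - 1) - f m) /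
          ((q : ℂ) ^ (2 * (m : ℤ) - 2) - (q : ℂ) ^ (2 * (m : ℤ)))) -
      (1 - (q : ℂ) ^ (2 * (m : ℤ) + 2)) * (f m - f (m + 1)) /
        ((q : ℂ) ^ (2 * (m : ℤ)) - (q : ℂ) ^ (2 * (m : ℤ) + 2))) /
    ((q : ℂ) ^ (2 * (m : ℤ) - 1) - (q : ℂ) ^ (2 * (m : ℤ) + 1))

/-- The q-analogue `f₀` of the delta-function at the centre of the disc:
`f₀(q⁰) = 1` and `f₀(q^{2k}) = 0` for `k ≥ 1`. -/
noncomputable def fZero : ℕ → ℂ := fun N => if N = 0 then 1 else 0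

theorem summable_norm_mul_pow (x : ℂ) {Q : ℂ} (hQ : ‖Q‖ < 1) :
    Summable fun j : ℕ => ‖-(x * Q ^ j)‖ := by
  simpa using (summable_geometric_of_lt_one (norm_nonneg Q) hQ).mul_left ‖x‖

theorem multipliable_one_sub_mul_pow (x : ℂ) {Q : ℂ} (hQ : ‖Q‖ < 1) :
    Multipliable fun j : ℕ => 1 - x * Q ^ j := by
  simpa [sub_eq_add_neg] using multipliable_one_add_of_summable (summable_norm_mul_pow x hQ)

theorem qPochInf_eq_mul (x : ℂ) {Q : ℂ} (hQ : ‖Q‖ < 1) :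
    qPochInf x Q = (1 - x) * qPochInf (x * Q) Q := by
  have e : ∀ j : ℕ, 1 - x * Q ^ (j + 1) = 1 - x * Q * Q ^ j := fun j => by ring
  have h : Multipliable fun j : ℕ => 1 - x * Q ^ (j + 1) :=
    (multipliable_one_sub_mul_pow (x * Q) hQ).congr fun j => (e j).symm
  have h2 := tprod_eq_zero_mul' (f := fun j : ℕ => 1 - x * Q ^ j) h
  rw [pow_zero, mul_one, tprod_congr e] at h2
  exact h2

theorem qPochInf_zero (Q : ℂ) : qPochInf 0 Q = 1 := by simp [qPochInf]

theorem qPochInf_ne_zero {x Q : ℂ} (hQ : ‖Q‖ < 1) (hx : ‖x‖ < 1) : qPochInf x Q ≠ 0 := by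
  have h := tprod_one_add_ne_zero_of_summable (f := fun j : ℕ => -(x * Q ^ j))
    (fun j h0 => ?_) (summable_norm_mul_pow x hQ)
  · simpa [qPochInf, sub_eq_add_neg] using h
  · have h1 : x * Q ^ j = 1 := by linear_combination -h0
    have h2 : ‖x‖ * ‖Q‖ ^ j = 1 := by rw [← norm_pow, ← norm_mul, h1, norm_one]
    have h3 : ‖Q‖ ^ j ≤ 1 := pow_le_one₀ (norm_nonneg _) hQ.le
    nlinarith [norm_nonneg x]

theorem differentiable_qPochInf {Q : ℂ} (hQ : ‖Q‖ < 1) :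
    Differentiable ℂ fun x => qPochInf x Q := by
  intro x
  have hU : IsOpen (Metric.ball (0 : ℂ) (‖x‖ + 1)) := Metric.isOpen_ball
  have hu : Summable fun j : ℕ => (‖x‖ + 1) * ‖Q‖ ^ j :=
    (summable_geometric_of_lt_one (norm_nonneg Q) hQ).mul_left _
  have h := hu.hasProdLocallyUniformlyOn_nat_one_add (f := fun j y => -(y * Q ^ j)) hU
    (.of_forall fun j y hy => by
      rw [norm_neg, norm_mul, norm_pow]
      have : ‖y‖ < ‖x‖ + 1 := by simpa using hy
      gcongr) (fun j => by fun_prop)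
  have hd := TendstoLocallyUniformlyOn.differentiableOn h
    (.of_forall fun s => by
      simpa [Finset.prod_fn] using DifferentiableOn.finsetProd (fun _ _ => by fun_prop)) hU
  have hx : x ∈ Metric.ball (0 : ℂ) (‖x‖ + 1) := by simp
  simpa [qPochInf, sub_eq_add_neg] using hd.differentiableAt (hU.mem_nhds hx)

theorem continuous_qPochInf {Q : ℂ} (hQ : ‖Q‖ < 1) : Continuous fun x => qPochInf x Q :=
  (differentiable_qPochInf hQ).continuous

theorem tendsto_qPoch {Q : ℂ} (hQ : ‖Q‖ < 1) (x : ℂ) :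
    Filter.Tendsto (fun n => qPoch x Q n) Filter.atTop (nhds (qPochInf x Q)) :=
  (multipliable_one_sub_mul_pow x hQ).tendsto_prod_tprod_nat

theorem qPochInf_conj (x : ℂ) (r : ℝ) (hr : ‖(r : ℂ)‖ < 1) :
    qPochInf (starRingEnd ℂ x) r = starRingEnd ℂ (qPochInf x r) := by
  unfold qPochInf
  rw [(multipliable_one_sub_mul_pow x hr).map_tprod (starRingEnd ℂ) Complex.continuous_conj]
  simp

theorem qPochInf_sq_arg {q : ℂ} (hq : ‖q‖ < 1) (x : ℂ) :
    qPochInf (x ^ 2) (q ^ 2) = qPochInf x (q ^ 2) * qPochInf (-x) (q ^ 2) *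
      (qPochInf (q * x) (q ^ 2) * qPochInf (-(q * x)) (q ^ 2)) := by
  have hQ : ‖q ^ 2‖ < 1 := by
    rw [norm_pow]; exact pow_lt_one₀ (norm_nonneg _) hq two_ne_zero
  have m := fun y => multipliable_one_sub_mul_pow y hQ
  have e1 : ∀ y, qPochInf y (q ^ 2) * qPochInf (-y) (q ^ 2) =
      ∏' j : ℕ, (1 - y ^ 2 * (q ^ 2) ^ (2 * j)) := by
    intro y
    unfold qPochInf
    rw [← (m y).tprod_mul (m (-y))]
    congr 1; ext j; ring
  have h2 : ∀ j : ℕ, (q ^ 2) ^ (2 * j) = ((q ^ 2) ^ 2) ^ j := fun j => by rw [pow_mul]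
  have hQ2 : ‖(q ^ 2) ^ 2‖ < 1 := by
    rw [norm_pow]; exact pow_lt_one₀ (norm_nonneg _) hQ two_ne_zero
  rw [e1, e1]
  unfold qPochInf
  rw [← tprod_even_mul_odd]
  · congr 2; ext j; ring
  · simpa only [h2] using multipliable_one_sub_mul_pow (x ^ 2) hQ2
  · have := multipliable_one_sub_mul_pow (x ^ 2 * q ^ 2) hQ2
    refine this.congr fun j => ?_
    rw [pow_succ (q ^ 2) (2 * j), h2]; ring

theorem norm_sq_lt_one {q : ℝ} (hq : q ∈ Set.Ioo (0 : ℝ) 1) : ‖(q : ℂ) ^ 2‖ < 1 := by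
  rw [norm_pow, Complex.norm_real, Real.norm_of_nonneg hq.1.le]
  exact pow_lt_one₀ hq.1.le hq.2 two_ne_zero

/-- The integrals of `f z / z` over concentric circles agree when `f` is holomorphic near the closed
annulus between them. -/
theorem integral_circle_eq_of_differentiableAt {q : ℝ} (hq : q ∈ Set.Ioo (0 : ℝ) 1) {f : ℂ → ℂ}
    (hf : ∀ z : ℂ, q ≤ ‖z‖ → ‖z‖ ≤ 1 → DifferentiableAt ℂ f z) :
    ∫ θ : ℝ in 0..2 * Real.pi, f (exp (θ * I)) =
      ∫ θ : ℝ in 0..2 * Real.pi, f (q * exp (θ * I)) := by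
  have key := circleIntegral_sub_center_inv_smul_eq_of_differentiable_on_annulus_off_countable
    (c := 0) (f := f) hq.1 hq.2.le Set.countable_empty
    (fun z hz => (hf z (by simpa using hz.2) (by simpa using hz.1)).continuousAt.continuousWithinAt)
    (fun z hz => hf z (le_of_lt (by simpa using hz.1.2)) (le_of_lt (by simpa using hz.1.1)))
  have e : ∀ R : ℝ, R ≠ 0 → (∮ z in C(0, R), (z - 0)⁻¹ • f z) =
      I * ∫ θ : ℝ in 0..2 * Real.pi, f (R * exp (θ * I)) := by
    intro R hR
    rw [circleIntegral, ← intervalIntegral.integral_const_mul]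
    congr 1; ext θ
    have : (R : ℂ) ≠ 0 := by exact_mod_cast hR
    have := exp_ne_zero (θ * I)
    simp only [deriv_circleMap, circleMap, zero_add, sub_zero, smul_eq_mul]
    field_simp
  rw [e 1 one_ne_zero, e q hq.1.ne'] at key
  simpa using mul_left_cancel₀ I_ne_zero key

theorem integral_circle_inv (f : ℂ → ℂ) :
    ∫ θ : ℝ in 0..2 * Real.pi, f (exp (θ * I))⁻¹ = ∫ θ : ℝ in 0..2 * Real.pi, f (exp (θ * I)) := by
  have h := intervalIntegral.integral_comp_sub_left (a := 0) (b := 2 * Real.pi)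
    (fun θ : ℝ => f (exp (θ * I))) (2 * Real.pi)
  rw [sub_self, sub_zero] at h
  rw [← h]
  congr 1; ext θ
  rw [← exp_neg, ← exp_periodic (-(θ * I))]
  congr 2; push_cast; ring

/-- The factor `(pz, p/z; Q)_∞` of the Askey–Wilson weight. -/
def awFactor (Q p z : ℂ) : ℂ := qPochInf (p * z) Q * qPochInf (p * z⁻¹) Q

/-- The Askey–Wilson weight with base `Q` and parameters `a, b, c, d`. -/
def awWeight (Q a b c d z : ℂ) : ℂ :=
  qPochInf (z ^ 2) Q * qPochInf (z⁻¹ ^ 2) Q /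
    (awFactor Q a z * awFactor Q b z * awFactor Q c z * awFactor Q d z)

/-- The Askey–Wilson integral over the unit circle. -/
def awIntegral (Q a b c d : ℂ) : ℂ :=
  ∫ θ : ℝ in 0..2 * Real.pi, awWeight Q a b c d (exp (θ * I))

theorem awFactor_inv (Q p z : ℂ) : awFactor Q p z⁻¹ = awFactor Q p z := by
  simp [awFactor, mul_comm]

theorem awWeight_inv (Q a b c d z : ℂ) : awWeight Q a b c d z⁻¹ = awWeight Q a b c d z := by
  simp [awWeight, awFactor_inv, mul_comm]

theorem awFactor_ne_zero {Q p z : ℂ} (hQ : ‖Q‖ < 1) (h1 : ‖p * z‖ < 1) (h2 : ‖p * z⁻¹‖ < 1) :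
    awFactor Q p z ≠ 0 :=
  mul_ne_zero (qPochInf_ne_zero hQ h1) (qPochInf_ne_zero hQ h2)

theorem awFactor_ne_zero_of_norm_eq_one {Q p z : ℂ} (hQ : ‖Q‖ < 1) (hp : ‖p‖ < 1) (hz : ‖z‖ = 1) :
    awFactor Q p z ≠ 0 :=
  awFactor_ne_zero hQ (by simpa [hz]) (by simpa [hz])

theorem differentiableAt_awFactor {Q p z : ℂ} (hQ : ‖Q‖ < 1) (hz : z ≠ 0) :
    DifferentiableAt ℂ (awFactor Q p) z := by
  have hE := differentiable_qPochInf hQ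
  exact (hE.differentiableAt.comp z (by fun_prop)).mul
    (hE.differentiableAt.comp z (by fun_prop (disch := assumption)))

theorem continuous_awFactor_exp {Q : ℂ} (hQ : ‖Q‖ < 1) (p : ℂ) :
    Continuous fun θ : ℝ => awFactor Q p (exp (θ * I)) := by
  have hE := continuous_qPochInf hQ
  simp only [awFactor, ← exp_neg]
  exact (hE.comp (by fun_prop)).mul (hE.comp (by fun_prop))

/-- The numerator-reduced weight: `awWeight = -(z - 1/z)² awReduced` on the unit circle. -/
def awReduced (Q a b c d z : ℂ) : ℂ :=
  qPochInf (z ^ 2 * Q) Q * qPochInf (z⁻¹ ^ 2 * Q) Q /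
    (awFactor Q a z * awFactor Q b z * awFactor Q c z * awFactor Q d z)

theorem awReduced_inv (Q a b c d z : ℂ) : awReduced Q a b c d z⁻¹ = awReduced Q a b c d z := by
  simp [awReduced, awFactor_inv, mul_comm]

theorem awWeight_eq_awReduced {Q : ℂ} (hQ : ‖Q‖ < 1) (a b c d : ℂ) {z : ℂ} (hz : z ≠ 0) :
    awWeight Q a b c d z = -(z - z⁻¹) ^ 2 * awReduced Q a b c d z := by
  rw [awWeight, qPochInf_eq_mul (z ^ 2) hQ, qPochInf_eq_mul (z⁻¹ ^ 2) hQ, awReduced]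
  rw [show (1 - z ^ 2) * qPochInf (z ^ 2 * Q) Q * ((1 - z⁻¹ ^ 2) * qPochInf (z⁻¹ ^ 2 * Q) Q) =
    (1 - z ^ 2) * (1 - z⁻¹ ^ 2) * (qPochInf (z ^ 2 * Q) Q * qPochInf (z⁻¹ ^ 2 * Q) Q) by ring,
    mul_div_assoc]
  congr 1
  field_simp
  ring

theorem continuous_awReduced_exp {Q a b c d : ℂ} (hQ : ‖Q‖ < 1) (ha : ‖a‖ < 1) (hb : ‖b‖ < 1)
    (hc : ‖c‖ < 1) (hd : ‖d‖ < 1) :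
    Continuous fun θ : ℝ => awReduced Q a b c d (exp (θ * I)) := by
  have hE := continuous_qPochInf hQ
  have hF := fun p => continuous_awFactor_exp hQ p
  have hn : ∀ θ : ℝ, ‖exp (θ * I)‖ = 1 := norm_exp_ofReal_mul_I
  simp only [awReduced]
  refine .div (.mul (hE.comp (by fun_prop)) (hE.comp ?_))
    ((((hF a).mul (hF b)).mul (hF c)).mul (hF d)) fun θ => ?_
  · simp only [← exp_neg]; fun_prop
  · have := fun p hp => awFactor_ne_zero_of_norm_eq_one (p := p) hQ hp (hn θ)
    simp [this a ha, this b hb, this c hc, this d hd]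

theorem awFactor_shift {q p z : ℂ} (hq : ‖q ^ 2‖ < 1) (hq0 : q ≠ 0) :
    awFactor (q ^ 2) p z = (1 - p * z) * awFactor (q ^ 2) (p * q) (q * z) := by
  simp only [awFactor]
  rw [qPochInf_eq_mul (p * z) hq, show p * q * (q * z) = p * z * q ^ 2 by ring,
    show p * q * (q * z)⁻¹ = p * z⁻¹ by field_simp]
  ring

theorem integral_awReduced_shift_eq_zero {q : ℝ} (hq : q ∈ Set.Ioo (0 : ℝ) 1) {a b c d : ℂ}
    (ha : ‖a‖ < 1) (hb : ‖b‖ < 1) (hc : ‖c‖ < 1) (hd : ‖d‖ < 1) :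
    ∫ θ : ℝ in 0..2 * Real.pi, (fun z : ℂ => (z - z⁻¹) * z⁻¹ ^ 2 *
      ((1 - a * z) * (1 - b * z) * (1 - c * z) * (1 - d * z)) *
        awReduced ((q : ℂ) ^ 2) a b c d z) (exp (θ * I)) = 0 := by
  have hQ := norm_sq_lt_one hq
  have hq0 : (q : ℂ) ≠ 0 := by exact_mod_cast hq.1.ne'
  have hn : ∀ θ : ℝ, ‖exp (θ * I)‖ = 1 := norm_exp_ofReal_mul_I
  set h : ℂ → ℂ := fun z => (z - z⁻¹) * awReduced ((q : ℂ) ^ 2) (a * q) (b * q) (c * q) (d * q) z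
    with h_def
  have hodd : ∫ θ : ℝ in 0..2 * Real.pi, h (exp (θ * I)) = 0 := by
    have h1 := integral_circle_inv h
    have h2 : ∀ z, h z⁻¹ = -h z := fun z => by
      simp only [h_def, awReduced_inv, inv_inv]; ring
    simp only [h2, intervalIntegral.integral_neg] at h1
    linear_combination (-1 / 2 : ℂ) * h1
  have hsub : ∀ p : ℂ, ‖p‖ < 1 → ∀ z : ℂ, q ≤ ‖z‖ → ‖z‖ ≤ 1 →
      awFactor ((q : ℂ) ^ 2) (p * q) z ≠ 0 := by
    intro p hp z h1 h2
    have hz : 0 < ‖z‖ := hq.1.trans_le h1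
    apply awFactor_ne_zero hQ
    · rw [norm_mul, norm_mul, norm_real, Real.norm_of_nonneg hq.1.le]
      have : q * ‖z‖ ≤ 1 := by nlinarith [hq.1, hq.2]
      nlinarith [norm_nonneg p, hq.1]
    · rw [norm_mul, norm_mul, norm_real, Real.norm_of_nonneg hq.1.le, norm_inv, mul_assoc]
      have : q * ‖z‖⁻¹ ≤ 1 := by rw [← div_eq_mul_inv, div_le_one hz]; exact h1
      have : 0 ≤ q * ‖z‖⁻¹ := mul_nonneg hq.1.le (by positivity)
      nlinarith [norm_nonneg p]
  have hdiff : ∀ z : ℂ, q ≤ ‖z‖ → ‖z‖ ≤ 1 → DifferentiableAt ℂ h z := by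
    intro z h1 h2
    have hz : z ≠ 0 := norm_pos_iff.mp (hq.1.trans_le h1)
    have hE := differentiable_qPochInf hQ
    have hF := fun p => differentiableAt_awFactor (p := p) hQ hz
    refine .mul (by fun_prop (disch := assumption)) (.div (.mul ?_ ?_)
      ((((hF _).mul (hF _)).mul (hF _)).mul (hF _)) ?_)
    · exact hE.differentiableAt.comp z (by fun_prop)
    · exact hE.differentiableAt.comp z (by fun_prop (disch := assumption))
    · simp [hsub a ha z h1 h2, hsub b hb z h1 h2, hsub c hc z h1 h2, hsub d hd z h1 h2]
  have hshift := integral_circle_eq_of_differentiableAt hq hdiff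
  rw [hodd] at hshift
  rw [← mul_right_inj' (a := -(q : ℂ)⁻¹) (by simpa using hq0), mul_zero, hshift,
    ← intervalIntegral.integral_const_mul]
  congr 1; ext θ
  have hz1 := hn θ
  have hz : exp (θ * I) ≠ 0 := exp_ne_zero _
  set z := exp (θ * I)
  simp only [h_def, awReduced]
  have hfac : ∀ p : ℂ, ‖p‖ < 1 → (1 - p * z) ≠ 0 ∧ awFactor ((q : ℂ) ^ 2) (p * q) (q * z) ≠ 0 := by
    intro p hp
    have := awFactor_ne_zero_of_norm_eq_one hQ hp hz1
    rw [awFactor_shift hQ hq0] at this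
    exact ⟨left_ne_zero_of_mul this, right_ne_zero_of_mul this⟩
  simp only [awFactor_shift (p := a) (z := z) hQ hq0, awFactor_shift (p := b) (z := z) hQ hq0,
    awFactor_shift (p := c) (z := z) hQ hq0, awFactor_shift (p := d) (z := z) hQ hq0]
  rw [qPochInf_eq_mul (z ^ 2 * (q : ℂ) ^ 2) hQ,
    show (q * z : ℂ) ^ 2 * (q : ℂ) ^ 2 = z ^ 2 * q ^ 2 * q ^ 2 by ring,
    show (q * z : ℂ)⁻¹ ^ 2 * (q : ℂ) ^ 2 = z⁻¹ ^ 2 by field_simp,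
    qPochInf_eq_mul (z⁻¹ ^ 2) hQ]
  obtain ⟨a1, a2⟩ := hfac a ha
  obtain ⟨b1, b2⟩ := hfac b hb
  obtain ⟨c1, c2⟩ := hfac c hc
  obtain ⟨d1, d2⟩ := hfac d hd
  generalize awFactor ((q : ℂ) ^ 2) (a * q) (q * z) = A at *
  generalize awFactor ((q : ℂ) ^ 2) (b * q) (q * z) = B at *
  generalize awFactor ((q : ℂ) ^ 2) (c * q) (q * z) = C at *
  generalize awFactor ((q : ℂ) ^ 2) (d * q) (q * z) = D at *
  generalize qPochInf (z ^ 2 * (q : ℂ) ^ 2 * (q : ℂ) ^ 2) ((q : ℂ) ^ 2) = E at *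
  generalize qPochInf (z⁻¹ ^ 2 * (q : ℂ) ^ 2) ((q : ℂ) ^ 2) = F at *
  generalize 1 - a * z = A' at *
  generalize 1 - b * z = B' at *
  generalize 1 - c * z = C' at *
  generalize 1 - d * z = D' at *
  field_simp
  ring

theorem qPoch_succ (x Q : ℂ) (n : ℕ) : qPoch x Q (n + 1) = qPoch x Q n * (1 - x * Q ^ n) :=
  Finset.prod_range_succ _ _

theorem qPochInf_eq_qPoch_mul (x : ℂ) {Q : ℂ} (hQ : ‖Q‖ < 1) (n : ℕ) :
    qPochInf x Q = qPoch x Q n * qPochInf (x * Q ^ n) Q := by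
  induction n with
  | zero => simp [qPoch]
  | succ n ih =>
    rw [ih, qPoch_succ, qPochInf_eq_mul (x * Q ^ n) hQ, pow_succ]
    ring_nf

theorem exists_norm_qPoch_le {Q : ℂ} (hQ : ‖Q‖ < 1) :
    ∃ C : ℝ, ∀ (x : ℂ) (n : ℕ), ‖x‖ ≤ 1 → ‖qPoch x Q n‖ ≤ C := by
  have h := (tendsto_qPoch (Q := (‖Q‖ : ℂ)) (by simpa using hQ) (-1)).norm.bddAbove_range
  obtain ⟨C, hC⟩ := h
  refine ⟨C, fun x n hx => le_trans ?_ (hC ⟨n, rfl⟩)⟩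
  simp only [qPoch, norm_prod]
  refine Finset.prod_le_prod (fun _ _ => norm_nonneg _) fun j _ => ?_
  have e : (1 : ℂ) - -1 * (‖Q‖ : ℂ) ^ j = ((1 + ‖Q‖ ^ j : ℝ) : ℂ) := by push_cast; ring
  rw [e, norm_real, Real.norm_of_nonneg (by positivity)]
  refine (norm_sub_le _ _).trans ?_
  rw [norm_one, norm_mul, norm_pow]
  have : 0 ≤ ‖Q‖ ^ j := by positivity
  nlinarith

theorem continuous_awWeight_exp {Q a b c d : ℂ} (hQ : ‖Q‖ < 1) (ha : ‖a‖ < 1) (hb : ‖b‖ < 1)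
    (hc : ‖c‖ < 1) (hd : ‖d‖ < 1) :
    Continuous fun θ : ℝ => awWeight Q a b c d (exp (θ * I)) := by
  simp only [awWeight_eq_awReduced hQ a b c d (exp_ne_zero _)]
  refine .mul ?_ (continuous_awReduced_exp hQ ha hb hc hd)
  simp only [← exp_neg]
  fun_prop

theorem awWeight_mul_pow {Q a b c d z : ℂ} (hQ : ‖Q‖ < 1) (ha : ‖a‖ < 1) (hz : ‖z‖ = 1) (n : ℕ) :
    awWeight Q (a * Q ^ n) b c d z =
      qPoch (a * z) Q n * qPoch (a * z⁻¹) Q n * awWeight Q a b c d z := by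
  have h : awFactor Q a z =
      qPoch (a * z) Q n * qPoch (a * z⁻¹) Q n * awFactor Q (a * Q ^ n) z := by
    simp only [awFactor]
    rw [qPochInf_eq_qPoch_mul (a * z) hQ n, qPochInf_eq_qPoch_mul (a * z⁻¹) hQ n]
    ring_nf
  have h0 := awFactor_ne_zero_of_norm_eq_one hQ ha hz
  rw [h] at h0
  simp only [awWeight, h]
  generalize qPoch (a * z) Q n = x at *
  generalize qPoch (a * z⁻¹) Q n = y at *
  have h1 := left_ne_zero_of_mul (left_ne_zero_of_mul h0)
  have h2 := right_ne_zero_of_mul (left_ne_zero_of_mul h0)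
  field_simp

theorem norm_mul_pow_lt_one {Q a : ℂ} (hQ : ‖Q‖ < 1) (ha : ‖a‖ < 1) (n : ℕ) :
    ‖a * Q ^ n‖ < 1 := by
  rw [norm_mul, norm_pow]
  exact mul_lt_one_of_nonneg_of_lt_one_left (norm_nonneg _) ha (pow_le_one₀ (norm_nonneg _) hQ.le)

theorem awIntegral_shift {q : ℝ} (hq : q ∈ Set.Ioo (0 : ℝ) 1) {a b c d : ℂ}
    (ha : ‖a‖ < 1) (hb : ‖b‖ < 1) (hc : ‖c‖ < 1) (hd : ‖d‖ < 1) :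
    (1 - a * b * c * d) * awIntegral ((q : ℂ) ^ 2) (a * (q : ℂ) ^ 2) b c d =
      (1 - a * b) * (1 - a * c) * (1 - a * d) * awIntegral ((q : ℂ) ^ 2) a b c d := by
  have hQ := norm_sq_lt_one hq
  have hn : ∀ θ : ℝ, ‖exp (θ * I)‖ = 1 := norm_exp_ofReal_mul_I
  have h1 := integral_awReduced_shift_eq_zero hq ha hb hc hd
  set f : ℂ → ℂ := fun z : ℂ => (z - z⁻¹) * z⁻¹ ^ 2 *
      ((1 - a * z) * (1 - b * z) * (1 - c * z) * (1 - d * z)) *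
        awReduced ((q : ℂ) ^ 2) a b c d z with hf
  have h2 := integral_circle_inv f
  rw [h1] at h2
  have hfc : Continuous fun θ : ℝ => f (exp (θ * I)) := by
    simp only [hf]
    refine .mul ?_ (continuous_awReduced_exp hQ ha hb hc hd)
    simp only [← exp_neg]
    fun_prop
  have hfc' : Continuous fun θ : ℝ => f (exp (θ * I))⁻¹ := by
    simp only [hf, awReduced_inv]
    refine .mul ?_ (continuous_awReduced_exp hQ ha hb hc hd)
    simp only [← exp_neg]
    fun_prop
  have haQ : ‖a * (q : ℂ) ^ 2‖ < 1 := by simpa using norm_mul_pow_lt_one hQ ha 1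
  have hW := continuous_awWeight_exp hQ ha hb hc hd
  have hW' := continuous_awWeight_exp hQ haQ hb hc hd
  rw [← sub_eq_zero, awIntegral, awIntegral, ← intervalIntegral.integral_const_mul,
    ← intervalIntegral.integral_const_mul, ← intervalIntegral.integral_sub
      ((hW'.const_mul _).intervalIntegrable _ _) ((hW.const_mul _).intervalIntegrable _ _)]
  trans ∫ θ : ℝ in 0..2 * Real.pi, -a * (f (exp (θ * I)) + f (exp (θ * I))⁻¹)
  · congr 1; ext θ
    have hz1 := hn θ
    have hz : exp (θ * I) ≠ 0 := exp_ne_zero _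
    set z := exp (θ * I)
    have e := awWeight_mul_pow (b := b) (c := c) (d := d) hQ ha hz1 1
    rw [pow_one] at e
    rw [e, awWeight_eq_awReduced hQ _ _ _ _ hz]
    simp only [hf, awReduced_inv, qPoch, Finset.prod_range_one, pow_zero, mul_one, inv_inv]
    generalize awReduced ((q : ℂ) ^ 2) a b c d z = R
    field_simp
    ring
  · rw [intervalIntegral.integral_const_mul, intervalIntegral.integral_add
      (hfc.intervalIntegrable _ _) (hfc'.intervalIntegrable _ _), h1, h2]
    simp

theorem awIntegral_mul_pow {q : ℝ} (hq : q ∈ Set.Ioo (0 : ℝ) 1) {a b c d : ℂ}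
    (ha : ‖a‖ < 1) (hb : ‖b‖ < 1) (hc : ‖c‖ < 1) (hd : ‖d‖ < 1) (n : ℕ) :
    qPoch (a * b * c * d) ((q : ℂ) ^ 2) n *
        awIntegral ((q : ℂ) ^ 2) (a * ((q : ℂ) ^ 2) ^ n) b c d =
      qPoch (a * b) ((q : ℂ) ^ 2) n * qPoch (a * c) ((q : ℂ) ^ 2) n *
        qPoch (a * d) ((q : ℂ) ^ 2) n * awIntegral ((q : ℂ) ^ 2) a b c d := by
  have hQ := norm_sq_lt_one hq
  induction n with
  | zero => simp [qPoch]
  | succ n ih =>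
    have h := awIntegral_shift hq (norm_mul_pow_lt_one hQ ha n) hb hc hd
    rw [mul_assoc a _ ((q : ℂ) ^ 2), ← pow_succ] at h
    simp only [qPoch_succ]
    linear_combination qPoch (a * b * c * d) ((q : ℂ) ^ 2) n * h +
      (1 - a * b * ((q : ℂ) ^ 2) ^ n) * (1 - a * c * ((q : ℂ) ^ 2) ^ n) *
        (1 - a * d * ((q : ℂ) ^ 2) ^ n) * ih

theorem tendsto_awIntegral_mul_pow {Q a b c d : ℂ} (hQ : ‖Q‖ < 1) (ha : ‖a‖ < 1) (hb : ‖b‖ < 1)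
    (hc : ‖c‖ < 1) (hd : ‖d‖ < 1) :
    Filter.Tendsto (fun n : ℕ => awIntegral Q (a * Q ^ n) b c d) Filter.atTop
      (nhds (awIntegral Q 0 b c d)) := by
  have hn : ∀ θ : ℝ, ‖exp (θ * I)‖ = 1 := norm_exp_ofReal_mul_I
  have hW := continuous_awWeight_exp hQ ha hb hc hd
  obtain ⟨C, hC⟩ := exists_norm_qPoch_le hQ
  have hC0 : 0 ≤ C := (norm_nonneg _).trans (hC 0 0 (by simp))
  refine intervalIntegral.tendsto_integral_filter_of_dominated_convergence
    (fun θ => C * C * ‖awWeight Q a b c d (exp (θ * I))‖) ?_ ?_ ?_ ?_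
  · exact .of_forall fun n =>
      (continuous_awWeight_exp hQ (norm_mul_pow_lt_one hQ ha n) hb hc hd).aestronglyMeasurable
  · refine .of_forall fun n => .of_forall fun θ _ => ?_
    rw [awWeight_mul_pow hQ ha (hn θ), norm_mul, norm_mul]
    gcongr
    · exact hC _ _ (by rw [norm_mul, hn, mul_one]; exact ha.le)
    · exact hC _ _ (by rw [norm_mul, norm_inv, hn, inv_one, mul_one]; exact ha.le)
  · exact (continuous_const.mul hW.norm).intervalIntegrable _ _
  · refine .of_forall fun θ _ => ?_
    simp only [awWeight_mul_pow hQ ha (hn θ)]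
    have h := ((tendsto_qPoch hQ (a * exp (θ * I))).mul
      (tendsto_qPoch hQ (a * (exp (θ * I))⁻¹))).mul_const (awWeight Q a b c d (exp (θ * I)))
    convert h using 2
    have h0 := awFactor_ne_zero_of_norm_eq_one hQ ha (hn θ)
    change _ = awFactor Q a (exp (θ * I)) * _
    have h1 : awFactor Q 0 (exp (θ * I)) = 1 := by simp [awFactor, qPochInf_zero]
    simp only [awWeight, h1]
    field_simp

theorem awIntegral_zero_left {q : ℝ} (hq : q ∈ Set.Ioo (0 : ℝ) 1) {a b c d : ℂ}
    (ha : ‖a‖ < 1) (hb : ‖b‖ < 1) (hc : ‖c‖ < 1) (hd : ‖d‖ < 1) :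
    qPochInf (a * b * c * d) ((q : ℂ) ^ 2) * awIntegral ((q : ℂ) ^ 2) 0 b c d =
      qPochInf (a * b) ((q : ℂ) ^ 2) * qPochInf (a * c) ((q : ℂ) ^ 2) *
        qPochInf (a * d) ((q : ℂ) ^ 2) * awIntegral ((q : ℂ) ^ 2) a b c d := by
  have hQ := norm_sq_lt_one hq
  have h1 := (tendsto_qPoch hQ (a * b * c * d)).mul (tendsto_awIntegral_mul_pow hQ ha hb hc hd)
  simp only [awIntegral_mul_pow hq ha hb hc hd] at h1
  exact tendsto_nhds_unique h1
    ((((tendsto_qPoch hQ _).mul (tendsto_qPoch hQ _)).mul (tendsto_qPoch hQ _)).mul_const _)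

theorem awIntegral_rotate (Q a b c d : ℂ) : awIntegral Q a b c d = awIntegral Q b c d a := by
  simp only [awIntegral, awWeight]
  congr 1; ext θ; ring

theorem awIntegral_base {q : ℝ} (hq : q ∈ Set.Ioo (0 : ℝ) 1) :
    awIntegral ((q : ℂ) ^ 2) (-(q : ℂ) ^ 2) q (-q) ((q : ℂ) ^ 2) = 4 * Real.pi := by
  have hQ := norm_sq_lt_one hq
  have hq1 : ‖(q : ℂ)‖ < 1 := by rw [norm_real, Real.norm_of_nonneg hq.1.le]; exact hq.2
  have hn : ∀ θ : ℝ, ‖exp (θ * I)‖ = 1 := norm_exp_ofReal_mul_I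
  have key : ∀ z : ℂ, qPochInf (z ^ 2) ((q : ℂ) ^ 2) = (1 - z ^ 2) *
      (qPochInf ((q : ℂ) ^ 2 * z) ((q : ℂ) ^ 2) * qPochInf (-(q : ℂ) ^ 2 * z) ((q : ℂ) ^ 2) *
        (qPochInf (q * z) ((q : ℂ) ^ 2) * qPochInf (-q * z) ((q : ℂ) ^ 2))) := by
    intro z
    rw [qPochInf_sq_arg hq1, qPochInf_eq_mul z hQ, qPochInf_eq_mul (-z) hQ]
    ring_nf
  have hW : ∀ θ : ℝ, awWeight ((q : ℂ) ^ 2) (-(q : ℂ) ^ 2) q (-q) ((q : ℂ) ^ 2) (exp (θ * I)) =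
      2 - exp (2 * I * θ) - exp (-(2 * I) * θ) := by
    intro θ
    have hz1 := hn θ
    have e1 : exp (2 * I * θ) = exp (θ * I) ^ 2 := by rw [← exp_nat_mul]; ring_nf
    have e2 : exp (-(2 * I) * θ) = (exp (θ * I))⁻¹ ^ 2 := by
      rw [← exp_neg, ← exp_nat_mul]; ring_nf
    have hz : exp (θ * I) ≠ 0 := exp_ne_zero _
    rw [e1, e2]
    set z := exp (θ * I)
    have ha := awFactor_ne_zero_of_norm_eq_one hQ hq1 hz1
    have hb := awFactor_ne_zero_of_norm_eq_one hQ (p := -q) (by rwa [norm_neg]) hz1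
    have hc := awFactor_ne_zero_of_norm_eq_one hQ hQ hz1
    have hd := awFactor_ne_zero_of_norm_eq_one hQ (p := -(q : ℂ) ^ 2) (by rwa [norm_neg]) hz1
    rw [awWeight, div_eq_iff (by simp [ha, hb, hc, hd])]
    rw [key z, key z⁻¹]
    simp only [awFactor]
    have : z * z⁻¹ = 1 := mul_inv_cancel₀ hz
    have h2 : (1 - z ^ 2) * (1 - z⁻¹ ^ 2) = 2 - z ^ 2 - z⁻¹ ^ 2 := by
      linear_combination (z * z⁻¹ + 1) * this
    rw [← h2]
    ring
  simp only [awIntegral, hW]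
  have hexp : ∀ c : ℂ, c ≠ 0 → exp (c * (2 * Real.pi : ℝ)) = 1 →
      ∫ θ : ℝ in 0..2 * Real.pi, exp (c * θ) = 0 := by
    intro c hc h1
    rw [integral_exp_mul_complex hc, h1]; simp
  rw [intervalIntegral.integral_sub, intervalIntegral.integral_sub, hexp, hexp]
  · simp; ring
  · simp
  · rw [exp_eq_one_iff]; exact ⟨-2, by push_cast; ring⟩
  · simp
  · rw [exp_eq_one_iff]; exact ⟨2, by push_cast; ring⟩
  all_goals exact Continuous.intervalIntegrable (by fun_prop) _ _

theorem awIntegral_self {q : ℝ} (hq : q ∈ Set.Ioo (0 : ℝ) 1) :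
    qPochInf ((q : ℂ) ^ 2) ((q : ℂ) ^ 2) ^ 2 * awIntegral ((q : ℂ) ^ 2) q q 0 0 =
      4 * Real.pi := by
  have hQ := norm_sq_lt_one hq
  have hq1 : ‖(q : ℂ)‖ < 1 := by rw [norm_real, Real.norm_of_nonneg hq.1.le]; exact hq.2
  have hq1' : ‖-(q : ℂ)‖ < 1 := by rwa [norm_neg]
  have hQ' : ‖-(q : ℂ) ^ 2‖ < 1 := by rwa [norm_neg]
  have h0 : ‖(0 : ℂ)‖ < 1 := by simp
  have s1 := awIntegral_zero_left hq hQ' hq1 hq1' hQ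
  have s2 := awIntegral_zero_left hq hQ h0 hq1 hq1'
  have s3 := awIntegral_zero_left hq hq1' h0 h0 hq1
  have s4 := awIntegral_zero_left hq hq1 h0 h0 hq1
  have r1 (a b c d : ℂ) : awIntegral ((q : ℂ) ^ 2) a b c d = awIntegral ((q : ℂ) ^ 2) d a b c := by
    rw [awIntegral_rotate _ d]
  rw [awIntegral_base hq, r1] at s1
  rw [r1 0 0] at s2
  rw [awIntegral_rotate _ q q]
  simp only [mul_zero, zero_mul, qPochInf_zero, one_mul, mul_one] at s2 s3 s4
  have f1 := qPochInf_eq_mul (q : ℂ) hQ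
  have f2 := qPochInf_eq_mul (-(q : ℂ)) hQ
  have f3 := qPochInf_eq_mul (-(q : ℂ) ^ 2) hQ
  have f4 := qPochInf_eq_mul ((q : ℂ) ^ 2) hQ
  have f5 := qPochInf_eq_mul ((q : ℂ) ^ 2 * (q : ℂ) ^ 2) hQ
  have f6 := qPochInf_sq_arg hq1 (q : ℂ)
  have n1 := qPochInf_ne_zero hQ hQ
  have t1 : -(q : ℂ) ^ 2 * q * -q * (q : ℂ) ^ 2 = (q : ℂ) ^ 2 * (q : ℂ) ^ 2 * (q : ℂ) ^ 2 := by ring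
  have t2 : -(q : ℂ) ^ 2 * q = -q * (q : ℂ) ^ 2 := by ring
  have t3 : -(q : ℂ) ^ 2 * -q = q * (q : ℂ) ^ 2 := by ring
  have t4 : (q : ℂ) ^ 2 * q = q * (q : ℂ) ^ 2 := by ring
  have t5 : (q : ℂ) ^ 2 * -q = -q * (q : ℂ) ^ 2 := by ring
  have t6 : -(q : ℂ) * q = -(q : ℂ) ^ 2 := by ring
  have t7 : (q : ℂ) * q = (q : ℂ) ^ 2 := by ring
  rw [t1, t2, t3] at s1
  rw [t4, t5] at s2
  rw [t6] at s3
  rw [t7] at s4 f6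
  generalize qPochInf ((q : ℂ) ^ 2 * (q : ℂ) ^ 2 * (q : ℂ) ^ 2) ((q : ℂ) ^ 2) = G3 at *
  generalize qPochInf ((q : ℂ) ^ 2 * (q : ℂ) ^ 2) ((q : ℂ) ^ 2) = G2 at *
  generalize qPochInf (-(q : ℂ) ^ 2 * (q : ℂ) ^ 2) ((q : ℂ) ^ 2) = H2 at *
  generalize qPochInf (-(q : ℂ) ^ 2) ((q : ℂ) ^ 2) = H1 at *
  generalize qPochInf ((q : ℂ) ^ 2) ((q : ℂ) ^ 2) = G1 at *
  generalize qPochInf (-(q : ℂ) * (q : ℂ) ^ 2) ((q : ℂ) ^ 2) = B2 at *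
  generalize qPochInf ((q : ℂ) * (q : ℂ) ^ 2) ((q : ℂ) ^ 2) = A2 at *
  generalize qPochInf (-(q : ℂ)) ((q : ℂ) ^ 2) = B1 at *
  generalize qPochInf (q : ℂ) ((q : ℂ) ^ 2) = A1 at *
  have hABH : A1 * B1 * H1 = 1 := mul_left_cancel₀ n1 (by linear_combination -f6)
  rw [f1, f2, f3] at hABH
  linear_combination -G1 * s4 + G1 * s3 + G1 * H1 * s2 +
    H1 * A2 * B2 * awIntegral ((q : ℂ) ^ 2) (q ^ 2) 0 q (-q) * (f4 + (1 - (q : ℂ) ^ 2) * f5) +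
    (1 - (q : ℂ) ^ 2) * (1 - (q : ℂ) ^ 4) * H1 * A2 * B2 * s1 +
    4 * Real.pi * ((1 - (q : ℂ) ^ 2) * (1 - (q : ℂ) ^ 4) * A2 ^ 2 * B2 ^ 2 * H2) * f3 +
    4 * Real.pi * ((1 - q) * A2 * ((1 + q) * B2) * ((1 + (q : ℂ) ^ 2) * H2) + 1) * hABH

theorem qPoch_succ_left (x Q : ℂ) (n : ℕ) : qPoch x Q (n + 1) = (1 - x) * qPoch (x * Q) Q n := by
  simp only [qPoch, Finset.prod_range_succ', pow_zero, mul_one]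
  rw [mul_comm]
  congr 1
  exact Finset.prod_congr rfl fun j _ => by ring

/-- Coefficient of the `k`-th term of the spherical function, with `Y = q^{-2n}`. -/
def sphCoeff (Q Y : ℂ) (k : ℕ) : ℂ := qPoch Y Q k * Q ^ k / qPoch Q Q k ^ 2

/-- The spherical function in terms of the multiplicative spectral parameter `z`. -/
def sphFun (q z : ℂ) (n : ℕ) : ℂ :=
  ∑ k ∈ Finset.range (n + 1), sphCoeff (q ^ 2) (q ^ (-(2 * (n : ℤ)))) k *
    (qPoch (q * z) (q ^ 2) k * qPoch (q * z⁻¹) (q ^ 2) k)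

theorem qPoch_self_ne_zero {Q : ℂ} (hQ : ‖Q‖ < 1) (k : ℕ) : qPoch Q Q k ≠ 0 := by
  have := qPochInf_ne_zero hQ hQ
  rw [qPochInf_eq_qPoch_mul Q hQ k] at this
  exact left_ne_zero_of_mul this

theorem one_sub_pow_succ_ne_zero {Q : ℂ} (hQ : ‖Q‖ < 1) (k : ℕ) : 1 - Q ^ (k + 1) ≠ 0 := by
  have := qPoch_self_ne_zero hQ (k + 1)
  rw [qPoch_succ, ← pow_succ'] at this
  exact right_ne_zero_of_mul this

theorem sphCoeff_recurrence {Q Y : ℂ} (hQ : ‖Q‖ < 1) (hQ0 : Q ≠ 0) (hY : Y ≠ 0) (k : ℕ) :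
    (1 - Q / Y) * (sphCoeff Q (Y / Q) (k + 1) - sphCoeff Q Y (k + 1)) +
        Q * ((1 - 1 / Y) * (sphCoeff Q (Y * Q) (k + 1) - sphCoeff Q Y (k + 1))) =
      -(sphCoeff Q Y k / Q ^ k) +
        (1 - Q ^ (k + 1)) * (1 - Q ^ (k + 2)) / Q ^ (k + 1) * sphCoeff Q Y (k + 1) := by
  have h1 : qPoch (Y / Q) Q (k + 1) = (1 - Y / Q) * qPoch Y Q k := by
    rw [qPoch_succ_left, div_mul_cancel₀ _ hQ0]
  have h2 : (1 - 1 / Y) * qPoch (Y * Q) Q (k + 1) =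
      -(1 / Y) * (qPoch Y Q k * (1 - Y * Q ^ k) * (1 - Y * Q ^ (k + 1))) := by
    rw [← qPoch_succ, ← qPoch_succ, qPoch_succ_left Y]
    field_simp
    ring
  have h3 := one_sub_pow_succ_ne_zero hQ k
  have h4 := qPoch_self_ne_zero hQ k
  have h5 : (1 - 1 / Y) * (sphCoeff Q (Y * Q) (k + 1) - sphCoeff Q Y (k + 1)) =
      (-(1 / Y) * (qPoch Y Q k * (1 - Y * Q ^ k) * (1 - Y * Q ^ (k + 1))) -
        (1 - 1 / Y) * qPoch Y Q (k + 1)) * Q ^ (k + 1) / qPoch Q Q (k + 1) ^ 2 := by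
    rw [← h2, sphCoeff, sphCoeff]; ring
  rw [h5]
  simp only [sphCoeff, h1, qPoch_succ _ _ k]
  rw [← pow_succ' Q k]
  generalize qPoch Y Q k = R
  generalize qPoch Q Q k = D at *
  have e1 : Q ^ (k + 2) = Q ^ k * Q ^ 2 := pow_add _ _ _
  rw [e1]
  rw [pow_succ] at *
  have hk : Q ^ k ≠ 0 := pow_ne_zero _ hQ0
  generalize Q ^ k = P at *
  have h6 : 1 - Q * P ≠ 0 := by rwa [mul_comm]
  field_simp
  ring

theorem sphCoeff_zpow_eq_zero {q : ℂ} (hq0 : q ≠ 0) {n k : ℕ} (h : n < k) :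
    sphCoeff (q ^ 2) (q ^ (-(2 * (n : ℤ)))) k = 0 := by
  have : qPoch (q ^ (-(2 * (n : ℤ)))) (q ^ 2) k = 0 := by
    refine Finset.prod_eq_zero (Finset.mem_range.mpr h) ?_
    rw [← pow_mul, ← zpow_natCast, ← zpow_add₀ hq0]
    simp
  rw [sphCoeff, this]; simp

theorem sphFun_eq_sum {q : ℂ} (hq0 : q ≠ 0) (z : ℂ) {n M : ℕ} (h : n + 1 ≤ M) :
    sphFun q z n = ∑ k ∈ Finset.range M, sphCoeff (q ^ 2) (q ^ (-(2 * (n : ℤ)))) k *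
      (qPoch (q * z) (q ^ 2) k * qPoch (q * z⁻¹) (q ^ 2) k) := by
  have hsub : Finset.range (n + 1) ⊆ Finset.range M := fun k hk => by
    simp only [Finset.mem_range] at hk ⊢; omega
  refine Finset.sum_subset hsub fun k _ hk => ?_
  have hnk : n < k := by rw [Finset.mem_range] at hk; omega
  rw [sphCoeff_zpow_eq_zero hq0 hnk, zero_mul]

theorem sphFun_recurrence {q z : ℂ} (hQ : ‖q ^ 2‖ < 1) (hq0 : q ≠ 0) (hz : z ≠ 0) (n : ℕ) :
    (1 - (q ^ 2) ^ (n + 1)) * (sphFun q z (n + 1) - sphFun q z n) +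
        q ^ 2 * ((1 - (q ^ 2) ^ n) * (sphFun q z (n - 1) - sphFun q z n)) =
      -((1 - q * z) * (1 - q * z⁻¹) * sphFun q z n) := by
  set Q := q ^ 2 with hQdef
  have hQ0 : Q ≠ 0 := pow_ne_zero _ hq0
  set B : ℕ → ℂ := fun k => qPoch (q * z) Q k * qPoch (q * z⁻¹) Q k with hB
  set Y : ℂ := q ^ (-(2 * (n : ℤ))) with hYdef
  have hY0 : Y ≠ 0 := zpow_ne_zero _ hq0
  have hYn : Q ^ n = 1 / Y := by
    rw [hYdef, zpow_neg, one_div, inv_inv, zpow_mul, zpow_natCast]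
    norm_cast
  have hYs : q ^ (-(2 * ((n + 1 : ℕ) : ℤ))) = Y / Q := by
    rw [hYdef, hQdef, ← zpow_natCast, ← zpow_sub₀ hq0]; congr 1; push_cast; ring
  have e0 : sphFun q z n = ∑ k ∈ Finset.range (n + 2), sphCoeff Q Y k * B k :=
    sphFun_eq_sum hq0 z (by omega)
  have e1 : sphFun q z (n + 1) = ∑ k ∈ Finset.range (n + 2), sphCoeff Q (Y / Q) k * B k := by
    rw [← hYs]; exact sphFun_eq_sum hq0 z (by omega)
  have e2 : (1 - 1 / Y) * sphFun q z (n - 1) =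
      (1 - 1 / Y) * ∑ k ∈ Finset.range (n + 2), sphCoeff Q (Y * Q) k * B k := by
    rcases n with _ | n
    · simp [hYdef]
    · congr 1
      have : Y * Q = q ^ (-(2 * (n : ℤ))) := by
        rw [hYdef, hQdef, ← zpow_natCast, ← zpow_add₀ hq0]; congr 1; push_cast; ring
      rw [this]
      exact sphFun_eq_sum hq0 z (by omega)
  have hstep : ∀ k, (1 - q * z) * (1 - q * z⁻¹) * B k =
      (B (k + 1) - (1 - Q ^ k) * (1 - Q ^ (k + 1)) * B k) / Q ^ k := by
    intro k
    have hk : Q ^ k ≠ 0 := pow_ne_zero _ hQ0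
    simp only [hB, qPoch_succ]
    rw [eq_div_iff hk]
    generalize qPoch (q * z) Q k = b1
    generalize qPoch (q * z⁻¹) Q k = b2
    have hzz : z * z⁻¹ = 1 := mul_inv_cancel₀ hz
    rw [pow_succ]
    have hQq : Q = q ^ 2 := rfl
    generalize Q ^ k = P at *
    rw [hQq]
    linear_combination (q ^ 2 * b1 * b2 * (P - P ^ 2)) * hzz
  have e3 : (1 - q * z) * (1 - q * z⁻¹) * sphFun q z n =
      ∑ k ∈ Finset.range (n + 1), (sphCoeff Q Y k / Q ^ k -
        (1 - Q ^ (k + 1)) * (1 - Q ^ (k + 2)) / Q ^ (k + 1) * sphCoeff Q Y (k + 1)) *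
          B (k + 1) := by
    have l1 : (1 - q * z) * (1 - q * z⁻¹) * sphFun q z n =
        ∑ k ∈ Finset.range (n + 1), sphCoeff Q Y k / Q ^ k * B (k + 1) -
        ∑ k ∈ Finset.range (n + 2),
          (1 - Q ^ k) * (1 - Q ^ (k + 1)) / Q ^ k * sphCoeff Q Y k * B k := by
      have : ∑ k ∈ Finset.range (n + 1), sphCoeff Q Y k / Q ^ k * B (k + 1) =
          ∑ k ∈ Finset.range (n + 2), sphCoeff Q Y k / Q ^ k * B (k + 1) := by
        rw [Finset.sum_range_succ _ (n + 1), sphCoeff_zpow_eq_zero hq0 (Nat.lt_succ_self n)]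
        simp
      rw [this, e0, Finset.mul_sum, ← Finset.sum_sub_distrib]
      refine Finset.sum_congr rfl fun k _ => ?_
      linear_combination sphCoeff Q Y k * hstep k
    rw [l1, Finset.sum_range_succ' _ (n + 1)]
    simp only [pow_zero, sub_self, zero_mul, zero_div, add_zero]
    rw [← Finset.sum_sub_distrib]
    exact Finset.sum_congr rfl fun k _ => by ring
  have hYn1 : Q ^ (n + 1) = Q / Y := by rw [pow_succ, hYn]; ring
  rw [e3, hYn1, hYn, mul_sub (1 - 1 / Y), e2, e1, e0, ← mul_sub (1 - 1 / Y),
    ← Finset.sum_sub_distrib, ← Finset.sum_sub_distrib, Finset.mul_sum, Finset.mul_sum,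
    Finset.mul_sum, ← Finset.sum_add_distrib, ← Finset.sum_neg_distrib, Finset.sum_range_succ']
  have hc0 : ∀ y, sphCoeff Q y 0 = 1 := by simp [sphCoeff, qPoch]
  simp only [hc0, sub_self, mul_zero, add_zero]
  refine Finset.sum_congr rfl fun k _ => ?_
  linear_combination B (k + 1) * sphCoeff_recurrence hQ hQ0 hY0 k

theorem sphFun_zero (q z : ℂ) : sphFun q z 0 = 1 := by simp [sphFun, sphCoeff, qPoch]

theorem sum_qPoch_mul_pow_div {Q : ℂ} (hQ : ‖Q‖ < 1) (Y : ℂ) (n : ℕ) :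
    ∑ k ∈ Finset.range (n + 1), qPoch Y Q k * Q ^ k / qPoch Q Q k =
      qPoch (Y * Q) Q n / qPoch Q Q n := by
  induction n with
  | zero => simp [qPoch]
  | succ n ih =>
    rw [Finset.sum_range_succ, ih, qPoch_succ Q, qPoch_succ (Y * Q), qPoch_succ_left Y]
    have h3 := one_sub_pow_succ_ne_zero hQ n
    have h4 := qPoch_self_ne_zero hQ n
    rw [← pow_succ']
    field_simp
    ring

/-- Coefficients of `(qt;q²)_∞ / (zt;q²)_∞` as a power series in `t`. -/
def ratioCoeff (q z : ℂ) (k : ℕ) : ℂ := qPoch (q * z⁻¹) (q ^ 2) k * z ^ k / qPoch (q ^ 2) (q ^ 2) k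

theorem ratioCoeff_functional {q z : ℂ} (hQ : ‖q ^ 2‖ < 1) (hz : z ≠ 0) :
    (1 - PowerSeries.C z * PowerSeries.X) * PowerSeries.mk (ratioCoeff q z) =
      (1 - PowerSeries.C q * PowerSeries.X) *
        PowerSeries.rescale (q ^ 2) (PowerSeries.mk (ratioCoeff q z)) := by
  ext n
  rcases n with _ | n
  · simp [sub_mul, mul_assoc]
    rw [← PowerSeries.coeff_zero_eq_constantCoeff_apply, PowerSeries.coeff_rescale]
    simp
  · simp only [sub_mul, one_mul, mul_assoc, map_sub, PowerSeries.coeff_C_mul,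
      PowerSeries.coeff_succ_X_mul, PowerSeries.coeff_rescale, PowerSeries.coeff_mk]
    have h3 := one_sub_pow_succ_ne_zero hQ n
    have h4 := qPoch_self_ne_zero hQ n
    simp only [ratioCoeff, qPoch_succ]
    rw [← pow_succ' (q ^ 2) n]
    field_simp
    ring

/-- The convolution form of the spherical function, up to the factor `q ^ n`. -/
def convCoeff (q z : ℂ) (n : ℕ) : ℂ :=
  ∑ p ∈ Finset.HasAntidiagonal.antidiagonal n, ratioCoeff q z p.1 * ratioCoeff q z⁻¹ p.2

theorem convCoeff_functional {q z : ℂ} (hQ : ‖q ^ 2‖ < 1) (hz : z ≠ 0) :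
    PowerSeries.mk (convCoeff q z) - PowerSeries.C (z + z⁻¹) *
        (PowerSeries.X * PowerSeries.mk (convCoeff q z)) +
        PowerSeries.X * (PowerSeries.X * PowerSeries.mk (convCoeff q z)) =
      PowerSeries.rescale (q ^ 2) (PowerSeries.mk (convCoeff q z)) - PowerSeries.C (2 * q) *
        (PowerSeries.X * PowerSeries.rescale (q ^ 2) (PowerSeries.mk (convCoeff q z))) +
        PowerSeries.C (q ^ 2) * (PowerSeries.X * (PowerSeries.X *
          PowerSeries.rescale (q ^ 2) (PowerSeries.mk (convCoeff q z)))) := by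
  have h : PowerSeries.mk (convCoeff q z) =
      PowerSeries.mk (ratioCoeff q z) * PowerSeries.mk (ratioCoeff q z⁻¹) := by
    ext n; simp [convCoeff, PowerSeries.coeff_mul]
  have h1 := ratioCoeff_functional hQ hz
  have h2 := ratioCoeff_functional hQ (inv_ne_zero hz)
  have h3 : (PowerSeries.C z * PowerSeries.C z⁻¹ : PowerSeries ℂ) = 1 := by
    rw [← map_mul, mul_inv_cancel₀ hz, map_one]
  rw [h, map_mul (PowerSeries.rescale (q ^ 2)), map_add PowerSeries.C, map_mul PowerSeries.C,
    map_pow PowerSeries.C, map_ofNat PowerSeries.C]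
  set A := PowerSeries.mk (ratioCoeff q z)
  set B := PowerSeries.mk (ratioCoeff q z⁻¹)
  linear_combination (1 - PowerSeries.C z⁻¹ * PowerSeries.X) * B * h1 +
    (1 - PowerSeries.C q * PowerSeries.X) * PowerSeries.rescale (q ^ 2) A * h2 -
    PowerSeries.X ^ 2 * A * B * h3

theorem convCoeff_zero (q z : ℂ) : convCoeff q z 0 = 1 := by
  simp [convCoeff, ratioCoeff, qPoch]

theorem sphFun_eq_convCoeff {q z : ℂ} (hQ : ‖q ^ 2‖ < 1) (hq0 : q ≠ 0) (hz : z ≠ 0) (n : ℕ) :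
    sphFun q z n = q ^ n * convCoeff q z n := by
  have hF := convCoeff_functional hQ hz
  have hzz : z * z⁻¹ = 1 := mul_inv_cancel₀ hz
  induction n using Nat.strong_induction_on with
  | _ n ih =>
    rcases n with _ | _ | n
    · simp [sphFun_zero, convCoeff_zero]
    · have h := congrArg (PowerSeries.coeff 1) hF
      have r := sphFun_recurrence hQ hq0 hz 0
      have hne := one_sub_pow_succ_ne_zero hQ 0
      have e1 : ∀ f : PowerSeries ℂ, PowerSeries.coeff 1 (PowerSeries.X * f) =
          PowerSeries.coeff 0 f := fun f => PowerSeries.coeff_succ_X_mul 0 f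
      simp only [map_add, map_sub, add_mul, PowerSeries.coeff_C_mul, e1,
        PowerSeries.coeff_zero_X_mul, convCoeff_zero, PowerSeries.coeff_rescale,
        PowerSeries.coeff_mk] at h
      simp only [sphFun_zero, pow_zero, sub_self, zero_mul, mul_zero, add_zero, zero_add] at r hne ⊢
      refine mul_left_cancel₀ hne ?_
      linear_combination r - q * h - q ^ 2 * hzz
    · have h := congrArg (PowerSeries.coeff (n + 1 + 1)) hF
      have r := sphFun_recurrence hQ hq0 hz (n + 1)
      have hne := one_sub_pow_succ_ne_zero hQ (n + 1)
      simp only [map_add, map_sub, add_mul, PowerSeries.coeff_C_mul, PowerSeries.coeff_succ_X_mul,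
        PowerSeries.coeff_rescale, PowerSeries.coeff_mk] at h
      rw [Nat.add_sub_cancel, ih n (by omega), ih (n + 1) (by omega)] at r
      refine mul_left_cancel₀ hne ?_
      linear_combination r - q ^ (n + 2) * h - q ^ (n + 1) * q ^ 2 * convCoeff q z (n + 1) * hzz

theorem norm_ofReal_lt_one {q : ℝ} (hq : q ∈ Set.Ioo (0 : ℝ) 1) : ‖(q : ℂ)‖ < 1 := by
  rw [norm_real, Real.norm_of_nonneg hq.1.le]; exact hq.2

theorem exists_norm_sphFun_le {q : ℂ} (hq : ‖q‖ < 1) (hq0 : q ≠ 0) :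
    ∃ K : ℝ, ∀ (z : ℂ) (n : ℕ), ‖z‖ = 1 → ‖sphFun q z n‖ ≤ K * ((n + 1) * ‖q‖ ^ n) := by
  have hQ : ‖q ^ 2‖ < 1 := by
    rw [norm_pow]; exact pow_lt_one₀ (norm_nonneg _) hq two_ne_zero
  obtain ⟨C, hC⟩ := exists_norm_qPoch_le hQ
  obtain ⟨D, hD⟩ := ((tendsto_qPoch hQ (q ^ 2)).inv₀ (qPochInf_ne_zero hQ hQ)).norm.bddAbove_range
  have hD' : ∀ k, ‖(qPoch (q ^ 2) (q ^ 2) k)⁻¹‖ ≤ D := fun k => hD ⟨k, rfl⟩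
  have hC0 : 0 ≤ C := (norm_nonneg _).trans (hC 0 0 (by simp))
  have hr : ∀ (z : ℂ) (k : ℕ), ‖z‖ = 1 → ‖ratioCoeff q z k‖ ≤ C * D := by
    intro z k hz
    rw [ratioCoeff, div_eq_mul_inv, norm_mul, norm_mul, norm_pow, hz, one_pow, mul_one]
    exact mul_le_mul (hC _ _ (by simpa [hz] using hq.le)) (hD' k) (norm_nonneg _) hC0
  refine ⟨(C * D) * (C * D), fun z n hz => ?_⟩
  have hz0 : z ≠ 0 := by rintro rfl; simp at hz
  have hCD : 0 ≤ C * D := (norm_nonneg _).trans (hr z 0 hz)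
  rw [sphFun_eq_convCoeff hQ hq0 hz0, norm_mul, norm_pow, convCoeff]
  have : ‖∑ p ∈ Finset.HasAntidiagonal.antidiagonal n, ratioCoeff q z p.1 * ratioCoeff q z⁻¹ p.2‖ ≤
      ∑ p ∈ Finset.HasAntidiagonal.antidiagonal n, (C * D) * (C * D) := by
    refine norm_sum_le_of_le _ fun p _ => ?_
    rw [norm_mul]
    exact mul_le_mul (hr z _ hz) (hr z⁻¹ _ (by simp [hz])) (norm_nonneg _) hCD
  rw [Finset.sum_const, Finset.Nat.card_antidiagonal, nsmul_eq_mul] at this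
  calc ‖q‖ ^ n * _ ≤ ‖q‖ ^ n * (((n + 1 : ℕ) : ℝ) * ((C * D) * (C * D))) := by gcongr
    _ = _ := by push_cast; ring

theorem continuous_sphFun_exp (q : ℂ) (n : ℕ) :
    Continuous fun θ : ℝ => sphFun q (exp (θ * I)) n := by
  simp only [sphFun, qPoch, ← exp_neg]
  fun_prop

theorem one_sub_mul_ne_zero {q z : ℂ} (hq : ‖q‖ < 1) (hz : ‖z‖ = 1) : 1 - q * z ≠ 0 := by
  intro h
  have h1 : q * z = 1 := by linear_combination -h
  have h2 := congrArg norm h1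
  rw [norm_mul, hz, mul_one, norm_one] at h2
  exact hq.ne h2

theorem integral_sphFun_mul_awWeight {q : ℝ} (hq : q ∈ Set.Ioo (0 : ℝ) 1) (n : ℕ) :
    ∫ θ : ℝ in 0..2 * Real.pi, sphFun q (exp (θ * I)) n *
        awWeight ((q : ℂ) ^ 2) q q 0 0 (exp (θ * I)) =
      awIntegral ((q : ℂ) ^ 2) q q 0 0 * fZero n := by
  have hQ := norm_sq_lt_one hq
  have hq1 := norm_ofReal_lt_one hq
  have hq0 : (q : ℂ) ≠ 0 := by exact_mod_cast hq.1.ne'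
  have h0 : ‖(0 : ℂ)‖ < 1 := by simp
  set Q := (q : ℂ) ^ 2 with hQdef
  set Y : ℂ := (q : ℂ) ^ (-(2 * (n : ℤ))) with hY
  have hw := continuous_awWeight_exp hQ hq1 hq1 h0 h0
  have hk : ∀ k : ℕ, ∫ θ : ℝ in 0..2 * Real.pi, sphCoeff Q Y k *
      (qPoch (q * exp (θ * I)) Q k * qPoch (q * (exp (θ * I))⁻¹) Q k *
        awWeight Q q q 0 0 (exp (θ * I))) =
      awIntegral Q q q 0 0 * (qPoch Y Q k * Q ^ k / qPoch Q Q k) := by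
    intro k
    have h := awIntegral_mul_pow hq hq1 hq1 h0 h0 k
    simp only [mul_zero] at h
    have hz : qPoch 0 Q k = 1 := by simp [qPoch]
    rw [← hQdef, hz, one_mul, mul_one, mul_one, ← sq, ← hQdef] at h
    rw [intervalIntegral.integral_const_mul]
    simp_rw [← awWeight_mul_pow hQ hq1 (norm_exp_ofReal_mul_I _) k]
    have h2 : ∫ θ : ℝ in 0..2 * Real.pi, awWeight Q (q * Q ^ k) q 0 0 (exp (θ * I)) =
      qPoch Q Q k * awIntegral Q q q 0 0 := h
    rw [h2, sphCoeff]
    have := qPoch_self_ne_zero hQ k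
    field_simp
  have hsum : ∀ θ : ℝ, sphFun q (exp (θ * I)) n * awWeight Q q q 0 0 (exp (θ * I)) =
      ∑ k ∈ Finset.range (n + 1), sphCoeff Q Y k *
      (qPoch (q * exp (θ * I)) Q k * qPoch (q * (exp (θ * I))⁻¹) Q k *
        awWeight Q q q 0 0 (exp (θ * I))) := by
    intro θ
    rw [sphFun, Finset.sum_mul]
    exact Finset.sum_congr rfl fun k _ => by rw [← hQdef, ← hY]; ring
  simp_rw [hsum]
  rw [intervalIntegral.integral_finsetSum]
  · simp_rw [hk]
    rw [← Finset.mul_sum, sum_qPoch_mul_pow_div hQ]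
    rcases n with _ | n
    · simp [qPoch, fZero]
    · have : qPoch (Y * Q) Q (n + 1) = 0 := by
        refine Finset.prod_eq_zero (Finset.mem_range.mpr (Nat.lt_succ_self n)) ?_
        rw [hY, hQdef, mul_assoc, ← pow_succ', ← pow_mul, ← zpow_natCast, ← zpow_add₀ hq0]
        simp
      simp [this, fZero]
  · intro k _
    refine Continuous.intervalIntegrable ?_ _ _
    refine continuous_const.mul (.mul ?_ hw)
    simp only [qPoch, ← exp_neg]
    fun_prop

/-- The `j`-th iterated Green sequence, up to normalization. -/
def greenSeq (q : ℝ) (j n : ℕ) : ℂ :=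
  ∫ θ : ℝ in 0..2 * Real.pi, sphFun q (exp (θ * I)) n /
    ((1 - q * exp (θ * I)) * (1 - q * (exp (θ * I))⁻¹)) ^ j *
      awWeight ((q : ℂ) ^ 2) q q 0 0 (exp (θ * I))

theorem continuous_greenIntegrand {q : ℝ} (hq : q ∈ Set.Ioo (0 : ℝ) 1) (j n : ℕ) :
    Continuous fun θ : ℝ => sphFun q (exp (θ * I)) n /
      ((1 - q * exp (θ * I)) * (1 - q * (exp (θ * I))⁻¹)) ^ j *
        awWeight ((q : ℂ) ^ 2) q q 0 0 (exp (θ * I)) := by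
  have h0 : ‖(0 : ℂ)‖ < 1 := by simp
  have hq1 := norm_ofReal_lt_one hq
  have hn : ∀ θ : ℝ, ‖exp (θ * I)‖ = 1 := norm_exp_ofReal_mul_I
  refine .mul (.div (continuous_sphFun_exp _ _) ?_ fun θ => ?_)
    (continuous_awWeight_exp (norm_sq_lt_one hq) hq1 hq1 h0 h0)
  · simp only [← exp_neg]
    fun_prop
  · exact pow_ne_zero _ (mul_ne_zero (one_sub_mul_ne_zero hq1 (hn θ))
      (one_sub_mul_ne_zero hq1 (by rw [norm_inv, hn, inv_one])))

theorem greenSeq_recurrence {q : ℝ} (hq : q ∈ Set.Ioo (0 : ℝ) 1) (j n : ℕ) :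
    (1 - ((q : ℂ) ^ 2) ^ (n + 1)) * (greenSeq q (j + 1) (n + 1) - greenSeq q (j + 1) n) +
        (q : ℂ) ^ 2 * ((1 - ((q : ℂ) ^ 2) ^ n) *
          (greenSeq q (j + 1) (n - 1) - greenSeq q (j + 1) n)) =
      -greenSeq q j n := by
  have hi := fun j n => (continuous_greenIntegrand hq j n).intervalIntegrable
    (μ := MeasureTheory.volume) 0 (2 * Real.pi)
  have hq1 := norm_ofReal_lt_one hq
  have hq0 : (q : ℂ) ≠ 0 := by exact_mod_cast hq.1.ne'
  unfold greenSeq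
  rw [← intervalIntegral.integral_sub (hi _ _) (hi _ _),
    ← intervalIntegral.integral_sub (hi _ _) (hi _ _), ← intervalIntegral.integral_const_mul,
    ← intervalIntegral.integral_const_mul, ← intervalIntegral.integral_const_mul,
    ← intervalIntegral.integral_add (((hi _ _).sub (hi _ _)).const_mul _)
      ((((hi _ _).sub (hi _ _)).const_mul _).const_mul _), ← intervalIntegral.integral_neg]
  congr 1
  ext θ
  have hn : ‖exp (θ * I)‖ = 1 := norm_exp_ofReal_mul_I θ
  have h1 := one_sub_mul_ne_zero hq1 hn
  have h2 : 1 - (q : ℂ) * (exp (θ * I))⁻¹ ≠ 0 :=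
    one_sub_mul_ne_zero hq1 (by rw [norm_inv, hn, inv_one])
  have hr := sphFun_recurrence (norm_sq_lt_one hq) hq0 (exp_ne_zero (θ * I)) n
  set L := (1 - q * exp (θ * I)) * (1 - q * (exp (θ * I))⁻¹) with hL
  have hL0 : L ≠ 0 := mul_ne_zero h1 h2
  have e : sphFun q (exp (θ * I)) n / L ^ j = L * sphFun q (exp (θ * I)) n / L ^ (j + 1) := by
    rw [pow_succ]; field_simp
  rw [e]
  linear_combination (awWeight ((q : ℂ) ^ 2) q q 0 0 (exp (θ * I)) / L ^ (j + 1)) * hr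

theorem tendsto_greenSeq {q : ℝ} (hq : q ∈ Set.Ioo (0 : ℝ) 1) (j : ℕ) :
    Filter.Tendsto (greenSeq q j) Filter.atTop (nhds 0) := by
  have hq1 := norm_ofReal_lt_one hq
  have hq0 : (q : ℂ) ≠ 0 := by exact_mod_cast hq.1.ne'
  obtain ⟨K, hK⟩ := exists_norm_sphFun_le hq1 hq0
  have hc := (continuous_greenIntegrand hq j 0).norm
  obtain ⟨M, hM⟩ := (isCompact_Icc (a := 0) (b := 2 * Real.pi)).bddAbove_image hc.continuousOn
  have hlim : Filter.Tendsto (fun n : ℕ => K * ((n + 1) * ‖(q : ℂ)‖ ^ n) * M * |2 * Real.pi - 0|)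
      Filter.atTop (nhds 0) := by
    have h1 := tendsto_self_mul_const_pow_of_lt_one (norm_nonneg _) hq1
    have h2 := tendsto_pow_atTop_nhds_zero_of_lt_one (norm_nonneg _) hq1
    simpa [add_mul] using (((h1.add h2).const_mul K).mul_const M).mul_const |2 * Real.pi - 0|
  refine squeeze_zero_norm (fun n => ?_) hlim
  refine intervalIntegral.norm_integral_le_of_norm_le_const fun θ hθ => ?_
  have hm := hM ⟨θ, Set.Ioc_subset_Icc_self (by
    rwa [Set.uIoc_of_le Real.two_pi_pos.le] at hθ), rfl⟩
  simp only [sphFun_zero, one_div] at hm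
  rw [div_eq_mul_inv, mul_assoc, norm_mul]
  have hb := hK _ n (norm_exp_ofReal_mul_I θ)
  exact mul_le_mul hb hm (norm_nonneg _) ((norm_nonneg _).trans hb)

theorem greenSeq_zero {q : ℝ} (hq : q ∈ Set.Ioo (0 : ℝ) 1) (n : ℕ) :
    greenSeq q 0 n = awIntegral ((q : ℂ) ^ 2) q q 0 0 * fZero n := by
  simp only [greenSeq, pow_zero, div_one]
  exact integral_sphFun_mul_awWeight hq n

theorem hQ_eq (q : ℝ) : hQ q = -(2 * Real.log q) := by
  rw [hQ, Real.log_zpow]; push_cast; ring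

theorem hQ_pos {q : ℝ} (hq : q ∈ Set.Ioo (0 : ℝ) 1) : 0 < hQ q := by
  rw [hQ_eq]; linarith [Real.log_neg hq.1 hq.2]

theorem qpow_add (q : ℝ) (v w : ℂ) : qpow q (v + w) = qpow q v * qpow q w := by
  rw [qpow, add_mul, exp_add]; rfl

theorem qpow_neg (q : ℝ) (w : ℂ) : qpow q (-w) = (qpow q w)⁻¹ := by
  rw [qpow, neg_mul, exp_neg]; rfl

theorem qpow_one {q : ℝ} (hq : 0 < q) : qpow q 1 = q := by
  rw [qpow, one_mul, ← ofReal_exp, Real.exp_log hq]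

theorem qpow_two_mul_I (q ρ : ℝ) : qpow q (2 * I * ρ) = (exp ((hQ q * ρ : ℝ) * I))⁻¹ := by
  rw [qpow, ← exp_neg, hQ_eq]; congr 1; push_cast; ring

theorem awWeight_self_eq_ofReal {q : ℝ} (hq : q ∈ Set.Ioo (0 : ℝ) 1) (θ : ℝ) :
    awWeight ((q : ℂ) ^ 2) q q 0 0 (exp (θ * I)) =
      ((‖qPochInf (exp (θ * I) ^ 2) ((q : ℂ) ^ 2)‖ ^ 2 /
        (‖qPochInf (q * exp (θ * I)) ((q : ℂ) ^ 2)‖ ^ 2) ^ 2 : ℝ) : ℂ) := by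
  have hc : (exp (θ * I))⁻¹ = starRingEnd ℂ (exp (θ * I)) := by
    rw [← exp_conj, ← exp_neg]; simp
  have hQ := norm_sq_lt_one hq
  rw [← ofReal_pow] at hQ ⊢
  have h1 : qPochInf ((exp (θ * I))⁻¹ ^ 2) ((q ^ 2 : ℝ) : ℂ) =
      starRingEnd ℂ (qPochInf (exp (θ * I) ^ 2) ((q ^ 2 : ℝ) : ℂ)) := by
    rw [← qPochInf_conj _ _ hQ, hc, map_pow]
  have h2 : qPochInf (q * (exp (θ * I))⁻¹) ((q ^ 2 : ℝ) : ℂ) =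
      starRingEnd ℂ (qPochInf (q * exp (θ * I)) ((q ^ 2 : ℝ) : ℂ)) := by
    rw [← qPochInf_conj _ _ hQ, hc, map_mul, conj_ofReal]
  simp only [awWeight, awFactor, zero_mul, qPochInf_zero, mul_one]
  rw [h1, h2, mul_conj', mul_conj']
  push_cast
  ring

theorem sigmaDensity_eq {q : ℝ} (hq : q ∈ Set.Ioo (0 : ℝ) 1) (ρ : ℝ) :
    sigmaDensity q ρ = hQ q * (qPochInf ((q : ℂ) ^ 2) ((q : ℂ) ^ 2) ^ 2 /
      (4 * Real.pi * (1 - (q : ℂ) ^ 2)) *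
        awWeight ((q : ℂ) ^ 2) q q 0 0 (exp ((hQ q * ρ : ℝ) * I))) := by
  have hQ' := norm_sq_lt_one hq
  have hE := qPochInf_ne_zero hQ' hQ'
  have h1 : (1 : ℂ) - (q : ℂ) ^ 2 ≠ 0 := by
    simpa using one_sub_pow_succ_ne_zero hQ' 0
  have hz := qpow_two_mul_I q ρ
  set ζ := exp ((hQ q * ρ : ℝ) * I) with hζ
  have e1 : qpow q (2 * (1 / 2 - I * (ρ : ℂ))) = q * ζ := by
    rw [show (2 : ℂ) * (1 / 2 - I * (ρ : ℂ)) = 1 + -(2 * I * ρ) by ring, qpow_add, qpow_one hq.1,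
      qpow_neg, hz, inv_inv]
  have e2 : qpow q (2 * (1 / 2 + I * (ρ : ℂ))) = q * ζ⁻¹ := by
    rw [show (2 : ℂ) * (1 / 2 + I * (ρ : ℂ)) = 1 + 2 * I * ρ by ring, qpow_add, qpow_one hq.1, hz]
  have e3 : qpow q (2 * (2 * I * (ρ : ℂ))) = ζ⁻¹ ^ 2 := by
    rw [two_mul, qpow_add, hz, sq]
  have e4 : qpow q (2 * -(2 * I * (ρ : ℂ))) = ζ ^ 2 := by
    rw [mul_neg, qpow_neg, e3, inv_pow, inv_inv]
  have p1 : ((1 : ℂ) - (q : ℂ) ^ 2) ^ (1 - -(2 * I * (ρ : ℂ))) =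
      (((1 : ℂ) - (q : ℂ) ^ 2) ^ (1 - (1 / 2 - I * (ρ : ℂ)))) ^ 2 := by
    rw [← cpow_nat_mul]; congr 1; push_cast; ring
  have p2 : ((1 : ℂ) - (q : ℂ) ^ 2) ^ (1 - (2 * I * (ρ : ℂ))) =
      (((1 : ℂ) - (q : ℂ) ^ 2) ^ (1 - (1 / 2 + I * (ρ : ℂ)))) ^ 2 := by
    rw [← cpow_nat_mul]; congr 1; push_cast; ring
  have n1 : ((1 : ℂ) - (q : ℂ) ^ 2) ^ (1 - (1 / 2 - I * (ρ : ℂ))) ≠ 0 := by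
    simp [cpow_eq_zero_iff, h1]
  have n2 : ((1 : ℂ) - (q : ℂ) ^ 2) ^ (1 - (1 / 2 + I * (ρ : ℂ))) ≠ 0 := by
    simp [cpow_eq_zero_iff, h1]
  have hπ : (Real.pi : ℂ) ≠ 0 := by exact_mod_cast Real.pi_ne_zero
  simp only [sigmaDensity, qGamma, awWeight, awFactor, e1, e2, e3, e4, p1, p2, zero_mul,
    qPochInf_zero, mul_one]
  generalize ((1 : ℂ) - (q : ℂ) ^ 2) ^ (1 - (1 / 2 - I * (ρ : ℂ))) = A at *
  generalize ((1 : ℂ) - (q : ℂ) ^ 2) ^ (1 - (1 / 2 + I * (ρ : ℂ))) = B at *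
  field_simp

theorem integral_sigmaMeasure {q : ℝ} (hq : q ∈ Set.Ioo (0 : ℝ) 1) (f : ℂ → ℂ) :
    ∫ ρ : ℝ, f (qpow q (2 * I * ρ)) ∂(sigmaMeasure q) =
      qPochInf ((q : ℂ) ^ 2) ((q : ℂ) ^ 2) ^ 2 / (4 * Real.pi * (1 - (q : ℂ) ^ 2)) *
        ∫ θ : ℝ in 0..2 * Real.pi, f (exp (θ * I)) *
          awWeight ((q : ℂ) ^ 2) q q 0 0 (exp (θ * I)) := by
  have hh := hQ_pos hq
  have hhC : (hQ q : ℂ) ≠ 0 := by exact_mod_cast hh.ne'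
  have hq1 := norm_ofReal_lt_one hq
  have h0 : ‖(0 : ℂ)‖ < 1 := by simp
  have hw := continuous_awWeight_exp (norm_sq_lt_one hq) hq1 hq1 h0 h0
  have hcont : Continuous (sigmaDensity q) := by
    rw [funext (sigmaDensity_eq hq)]
    exact continuous_const.mul (continuous_const.mul
      (hw.comp (continuous_const.mul continuous_id)))
  have hre : ∀ ρ, 0 ≤ (sigmaDensity q ρ).re ∧ ((sigmaDensity q ρ).re : ℂ) = sigmaDensity q ρ := by
    intro ρ
    have hQ := norm_sq_lt_one hq
    have hE : qPochInf ((q : ℂ) ^ 2) ((q : ℂ) ^ 2) =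
        ((qPochInf ((q : ℂ) ^ 2) ((q : ℂ) ^ 2)).re : ℂ) := by
      rw [eq_comm, ← conj_eq_iff_re]
      rw [← ofReal_pow] at hQ ⊢
      rw [← qPochInf_conj _ _ hQ, conj_ofReal]
    rw [sigmaDensity_eq hq, awWeight_self_eq_ofReal hq, hE]
    generalize (qPochInf ((q : ℂ) ^ 2) ((q : ℂ) ^ 2)).re = e
    have hq2 : 0 < 1 - q ^ 2 := by nlinarith [hq.1, hq.2]
    have hpi := Real.pi_pos
    norm_cast
    refine ⟨?_, rfl⟩
    positivity
  have hmeas : Measurable fun ρ : ℝ => ENNReal.ofReal (sigmaDensity q ρ).re :=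
    (Complex.measurable_re.comp hcont.measurable).ennreal_ofReal
  rw [sigmaMeasure, integral_withDensity_eq_integral_toReal_smul hmeas (by simp)]
  simp only [ENNReal.toReal_ofReal (hre _).1, real_smul, (hre _).2]
  rw [MeasureTheory.integral_Icc_eq_integral_Ioc, ← intervalIntegral.integral_of_le (by positivity)]
  simp only [sigmaDensity_eq hq, qpow_two_mul_I]
  have hs := intervalIntegral.integral_comp_mul_left (a := 0) (b := 2 * Real.pi / hQ q)
    (fun θ : ℝ => hQ q * (qPochInf ((q : ℂ) ^ 2) ((q : ℂ) ^ 2) ^ 2 /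
      (4 * Real.pi * (1 - (q : ℂ) ^ 2)) *
        awWeight ((q : ℂ) ^ 2) q q 0 0 (exp (θ * I))) * f (exp (θ * I))⁻¹) hh.ne'
  refine hs.trans ?_
  have hi := integral_circle_inv fun z => f z * awWeight ((q : ℂ) ^ 2) q q 0 0 z
  simp only [awWeight_inv] at hi
  rw [mul_zero, mul_div_cancel₀ _ hh.ne', ← hi, real_smul,
    ← intervalIntegral.integral_const_mul, ← intervalIntegral.integral_const_mul]
  congr 1
  ext θ
  push_cast
  field_simp

theorem phiQ_eq_sphFun {q : ℝ} (hq : q ∈ Set.Ioo (0 : ℝ) 1) (ρ : ℂ) (n : ℕ) :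
    phiQ q ρ n = sphFun q (qpow q (2 * I * ρ)) n := by
  have e1 : qpow q (1 + 2 * I * ρ) = q * qpow q (2 * I * ρ) := by
    rw [qpow_add, qpow_one hq.1]
  have e2 : qpow q (1 - 2 * I * ρ) = q * (qpow q (2 * I * ρ))⁻¹ := by
    rw [sub_eq_add_neg, qpow_add, qpow_one hq.1, qpow_neg]
  simp only [phiQ, sphFun, sphCoeff, e1, e2]
  exact Finset.sum_congr rfl fun k _ => by rw [pow_mul (q : ℂ) 2 k]; ring

theorem integral_phiQ_eq_greenSeq {q : ℝ} (hq : q ∈ Set.Ioo (0 : ℝ) 1) (m n : ℕ) :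
    ∫ ρ : ℝ, phiQ q (ρ : ℂ) n /
        ((1 - qpow q (1 + 2 * I * (ρ : ℂ))) ^ m * (1 - qpow q (1 - 2 * I * (ρ : ℂ))) ^ m)
      ∂(sigmaMeasure q) =
      qPochInf ((q : ℂ) ^ 2) ((q : ℂ) ^ 2) ^ 2 / (4 * Real.pi * (1 - (q : ℂ) ^ 2)) *
        greenSeq q m n := by
  rw [greenSeq, ← integral_sigmaMeasure hq (fun z => sphFun q z n /
    ((1 - q * z) * (1 - q * z⁻¹)) ^ m)]
  congr 1
  ext ρ
  rw [phiQ_eq_sphFun hq, qpow_add, sub_eq_add_neg (1 : ℂ) (2 * I * ρ), qpow_add, qpow_one hq.1,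
    qpow_neg, mul_pow]

theorem DeltaQ_eq {q : ℝ} (hq : q ∈ Set.Ioo (0 : ℝ) 1) (f : ℕ → ℂ) (n : ℕ) :
    DeltaQ q f n = ((1 - ((q : ℂ) ^ 2) ^ (n + 1)) * (f (n + 1) - f n) +
      (q : ℂ) ^ 2 * ((1 - ((q : ℂ) ^ 2) ^ n) * (f (n - 1) - f n))) / (1 - (q : ℂ) ^ 2) ^ 2 := by
  have hq0 : (q : ℂ) ≠ 0 := by exact_mod_cast hq.1.ne'
  have h1 : (1 : ℂ) - (q : ℂ) ^ 2 ≠ 0 := by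
    simpa using one_sub_pow_succ_ne_zero (norm_sq_lt_one hq) 0
  have hx : ((q : ℂ) ^ 2) ^ n ≠ 0 := pow_ne_zero _ (pow_ne_zero _ hq0)
  have e0 : (q : ℂ) ^ (2 * (n : ℤ)) = ((q : ℂ) ^ 2) ^ n := by
    rw [zpow_mul, zpow_natCast]; norm_cast
  have e1 : (q : ℂ) ^ (4 * (n : ℤ)) = (((q : ℂ) ^ 2) ^ n) ^ 2 := by
    rw [← e0, ← zpow_natCast, ← zpow_mul]; congr 1; push_cast; ring
  have e2 : (q : ℂ) ^ (2 * (n : ℤ) + 2) = ((q : ℂ) ^ 2) ^ n * (q : ℂ) ^ 2 := by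
    rw [zpow_add₀ hq0, e0]; norm_cast
  have e3 : (q : ℂ) ^ (2 * (n : ℤ) - 2) = ((q : ℂ) ^ 2) ^ n / (q : ℂ) ^ 2 := by
    rw [zpow_sub₀ hq0, e0]; norm_cast
  have e4 : (q : ℂ) ^ (2 * (n : ℤ) - 1) = ((q : ℂ) ^ 2) ^ n / q := by
    rw [zpow_sub₀ hq0, e0, zpow_one]
  have e5 : (q : ℂ) ^ (2 * (n : ℤ) + 1) = ((q : ℂ) ^ 2) ^ n * q := by
    rw [zpow_add₀ hq0, e0, zpow_one]
  have d1 : ((q : ℂ) ^ 2) ^ n / (q : ℂ) ^ 2 - ((q : ℂ) ^ 2) ^ n =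
      ((q : ℂ) ^ 2) ^ n * (1 - (q : ℂ) ^ 2) / (q : ℂ) ^ 2 := by field_simp
  have d2 : ((q : ℂ) ^ 2) ^ n - ((q : ℂ) ^ 2) ^ n * (q : ℂ) ^ 2 =
      ((q : ℂ) ^ 2) ^ n * (1 - (q : ℂ) ^ 2) := by ring
  have d3 : ((q : ℂ) ^ 2) ^ n / (q : ℂ) - ((q : ℂ) ^ 2) ^ n * q =
      ((q : ℂ) ^ 2) ^ n * (1 - (q : ℂ) ^ 2) / q := by field_simp
  have hif : (if n = 0 then (0 : ℂ) else (1 - (q : ℂ) ^ (2 * (n : ℤ))) * (f (n - 1) - f n) /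
          ((q : ℂ) ^ (2 * (n : ℤ) - 2) - (q : ℂ) ^ (2 * (n : ℤ)))) =
      (1 - (q : ℂ) ^ (2 * (n : ℤ))) * (f (n - 1) - f n) /
          ((q : ℂ) ^ (2 * (n : ℤ) - 2) - (q : ℂ) ^ (2 * (n : ℤ))) := by
    rcases n with _ | n <;> simp
  simp only [DeltaQ]
  rw [hif, e0, e1, e2, e3, e4, e5, d1, d2, d3, pow_succ ((q : ℂ) ^ 2) n, zpow_neg_one]
  generalize ((q : ℂ) ^ 2) ^ n = x at *
  field_simp
  ring

theorem tendsto_DeltaQ {q : ℝ} (hq : q ∈ Set.Ioo (0 : ℝ) 1) {f : ℕ → ℂ}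
    (hf : Filter.Tendsto f Filter.atTop (nhds 0)) :
    Filter.Tendsto (DeltaQ q f) Filter.atTop (nhds 0) := by
  have hQ := tendsto_pow_atTop_nhds_zero_of_norm_lt_one (norm_sq_lt_one hq)
  have h1 := (Filter.tendsto_add_atTop_iff_nat 1).mpr hf
  have h2 := hf.comp (Filter.tendsto_sub_atTop_nat 1)
  have h3 := (Filter.tendsto_add_atTop_iff_nat 1).mpr hQ
  rw [funext (DeltaQ_eq hq f)]
  have := ((((h3.const_sub 1).mul (h1.sub hf)).add
    (((hQ.const_sub 1).mul (h2.sub hf)).const_mul ((q : ℂ) ^ 2))).div_const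
      ((1 - (q : ℂ) ^ 2) ^ 2))
  simpa using this

theorem eq_of_DeltaQ_eq {q : ℝ} (hq : q ∈ Set.Ioo (0 : ℝ) 1) {F H : ℕ → ℂ}
    (hF : Filter.Tendsto F Filter.atTop (nhds 0)) (hH : Filter.Tendsto H Filter.atTop (nhds 0))
    (h : DeltaQ q F = DeltaQ q H) : F = H := by
  have h1 : (1 : ℂ) - (q : ℂ) ^ 2 ≠ 0 := by
    simpa using one_sub_pow_succ_ne_zero (norm_sq_lt_one hq) 0
  have hconst : ∀ n, F (n + 1) - H (n + 1) = F n - H n := by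
    intro n
    have hn := congrFun h n
    rw [DeltaQ_eq hq, DeltaQ_eq hq, div_left_inj' (pow_ne_zero 2 h1)] at hn
    have hne := one_sub_pow_succ_ne_zero (norm_sq_lt_one hq) n
    refine mul_left_cancel₀ hne ?_
    induction n with
    | zero =>
      simp only [pow_zero, sub_self, mul_zero, add_zero] at hn
      linear_combination hn
    | succ n ih =>
      have hn' := congrFun h n
      rw [DeltaQ_eq hq, DeltaQ_eq hq, div_left_inj' (pow_ne_zero 2 h1)] at hn'
      have := ih hn' (one_sub_pow_succ_ne_zero (norm_sq_lt_one hq) n)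
      rw [Nat.add_sub_cancel] at hn
      linear_combination hn + (q : ℂ) ^ 2 * this
  have hall : ∀ n, F n - H n = F 0 - H 0 := by
    intro n
    induction n with
    | zero => rfl
    | succ n ih => rw [hconst, ih]
  have hlim := hF.sub hH
  rw [funext hall, sub_zero] at hlim
  have h0 := tendsto_nhds_unique hlim tendsto_const_nhds
  ext n
  rw [← sub_eq_zero, hall, ← h0]

theorem tendsto_zero_of_summable {q : ℝ} (hq : q ∈ Set.Ioo (0 : ℝ) 1) {g : ℕ → ℂ}
    (hg : Summable (fun N : ℕ => ‖g N‖ ^ 2 * q ^ (-(2 * (N : ℤ))))) :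
    Filter.Tendsto g Filter.atTop (nhds 0) := by
  have h1 : Filter.Tendsto (fun N => ‖g N‖ ^ 2) Filter.atTop (nhds 0) := by
    refine squeeze_zero (fun N => sq_nonneg _) (fun N => ?_) hg.tendsto_atTop_zero
    refine le_mul_of_one_le_right (sq_nonneg _) ?_
    rw [zpow_neg]
    refine (one_le_inv₀ (zpow_pos hq.1 _)).mpr ?_
    exact_mod_cast pow_le_one₀ hq.1.le hq.2.le (n := 2 * N)
  rw [tendsto_zero_iff_norm_tendsto_zero]
  have h2 := h1.sqrt
  simpa [Real.sqrt_sq (norm_nonneg _)] using h2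

/-- The normalized iterated Green sequences. -/
def greenFun (q : ℝ) (j n : ℕ) : ℂ :=
  (-1) ^ j * (1 - (q : ℂ) ^ 2) ^ (2 * j + 1) *
    (qPochInf ((q : ℂ) ^ 2) ((q : ℂ) ^ 2) ^ 2 / (4 * Real.pi * (1 - (q : ℂ) ^ 2)) *
      greenSeq q j n)

theorem greenFun_zero {q : ℝ} (hq : q ∈ Set.Ioo (0 : ℝ) 1) : greenFun q 0 = fZero := by
  have h1 : (1 : ℂ) - (q : ℂ) ^ 2 ≠ 0 := by
    simpa using one_sub_pow_succ_ne_zero (norm_sq_lt_one hq) 0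
  have hπ : (Real.pi : ℂ) ≠ 0 := by exact_mod_cast Real.pi_ne_zero
  ext n
  rw [greenFun, greenSeq_zero hq, div_mul_eq_mul_div, ← mul_assoc (_ ^ 2), awIntegral_self hq]
  simp only [pow_zero, one_mul, mul_zero, zero_add, pow_one]
  field_simp

theorem DeltaQ_greenFun {q : ℝ} (hq : q ∈ Set.Ioo (0 : ℝ) 1) (j : ℕ) :
    DeltaQ q (greenFun q (j + 1)) = greenFun q j := by
  have h1 : (1 : ℂ) - (q : ℂ) ^ 2 ≠ 0 := by
    simpa using one_sub_pow_succ_ne_zero (norm_sq_lt_one hq) 0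
  ext n
  rw [DeltaQ_eq hq, div_eq_iff (pow_ne_zero 2 h1)]
  simp only [greenFun]
  linear_combination (-1) ^ (j + 1) * (1 - (q : ℂ) ^ 2) ^ (2 * (j + 1) + 1) *
    (qPochInf ((q : ℂ) ^ 2) ((q : ℂ) ^ 2) ^ 2 / (4 * Real.pi * (1 - (q : ℂ) ^ 2))) *
      greenSeq_recurrence hq j n

theorem tendsto_greenFun {q : ℝ} (hq : q ∈ Set.Ioo (0 : ℝ) 1) (j : ℕ) :
    Filter.Tendsto (greenFun q j) Filter.atTop (nhds 0) := by
  have h := ((tendsto_greenSeq hq j).const_mul (qPochInf ((q : ℂ) ^ 2) ((q : ℂ) ^ 2) ^ 2 /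
    (4 * Real.pi * (1 - (q : ℂ) ^ 2)))).const_mul ((-1) ^ j * (1 - (q : ℂ) ^ 2) ^ (2 * j + 1))
  rwa [mul_zero, mul_zero] at h

theorem eq_greenFun_of_iterate {q : ℝ} (hq : q ∈ Set.Ioo (0 : ℝ) 1) (m : ℕ) :
    ∀ g : ℕ → ℂ, Filter.Tendsto g Filter.atTop (nhds 0) → (DeltaQ q)^[m] g = fZero →
      g = greenFun q m := by
  induction m with
  | zero => intro g _ h; rw [greenFun_zero hq]; exact h
  | succ m ih =>
    intro g hg h
    refine eq_of_DeltaQ_eq hq hg (tendsto_greenFun hq _) ?_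
    rw [DeltaQ_greenFun hq]
    exact ih _ (tendsto_DeltaQ hq hg) h

/-- if `g ∈ L²(dν)q⁰` satisfies `Δ^m g = f₀` (`m ≥ 1`), then
`g(q^{2N}) = (−1)^m (1−q²)^{2m+1} ∫_0^{2π/h} φ_ρ(q^{2N}) / ((1−q^{1+2iρ})^m (1−q^{1−2iρ})^m) dσ(ρ)`. -/
theorem green_function_spherical_formula (q : ℝ) (hq : q ∈ Set.Ioo (0 : ℝ) 1)
    (m : ℕ) (hm : 1 ≤ m) (g : ℕ → ℂ)
    (hg : Summable (fun N : ℕ => ‖g N‖ ^ 2 * q ^ (-(2 * (N : ℤ)))))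
    (hgm : (DeltaQ q)^[m] g = fZero) :
    ∀ N : ℕ,
      g N = (-1 : ℂ) ^ m * (1 - (q : ℂ) ^ 2) ^ (2 * m + 1) *
        ∫ ρ : ℝ, phiQ q (ρ : ℂ) N /
            ((1 - qpow q (1 + 2 * I * (ρ : ℂ))) ^ m * (1 - qpow q (1 - 2 * I * (ρ : ℂ))) ^ m)
          ∂(sigmaMeasure q) := by
  intro N
  rw [integral_phiQ_eq_greenSeq hq,
    eq_greenFun_of_iterate hq m g (tendsto_zero_of_summable hq hg) hgm, greenFun]

end
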